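/- arXiv:2211.01307 — 2 statements merged into one kernel-verified Lean document; each statement's English description precedes it below -/
import Mathlib

section
/- Let 𝔗 be the uniform spanning tree of Z^4 and for r, n ≥ 1 let ℰ(r,n) be the event that there exists a path in 𝔗 from ∂Λ(r) to ∂Λ(4r) of length at most n. Then P( ℰ(r, ⌈r²(log r)^{-3}⌉) ) = exp[ −Ω((log r)²) ] as r → ∞; that is, there exist constants c > 0 and r_0 such that this probability is at most exp(−c(log r)²) for all r ≥ r_0. -/
open MeasureTheory Filter Set
open scoped ENNReal Classical Topology

noncomputable section

abbrev V4 : Type := Fin 4 → ℤ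

/-- Nearest-neighbour adjacency in `ℤ⁴`. -/
def latAdj (x y : V4) : Prop := ∑ i, |x i - y i| = 1

/-- The vertices of the box `[-n,n]⁴`. -/
def boxV (n : ℕ) : Finset V4 := Fintype.piFinset fun _ => Finset.Icc (-(n : ℤ)) (n : ℤ)

/-- The nearest-neighbour edges of the box `[-n,n]⁴`. -/
def boxEdges (n : ℕ) : Finset (Sym2 V4) :=
  ((boxV n ×ˢ boxV n).filter fun p => latAdj p.1 p.2).image fun p => s(p.1, p.2)

/-- `x` and `y` are connected using edges from `T`. -/
def connIn (T : Set (Sym2 V4)) (x y : V4) : Prop :=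
  Relation.ReflTransGen (fun a b => s(a, b) ∈ T) x y

/-- `T` is a spanning tree of the box `[-n,n]⁴`. -/
def IsBoxSpanningTree (n : ℕ) (T : Finset (Sym2 V4)) : Prop :=
  T ⊆ boxEdges n ∧ (∀ x ∈ boxV n, ∀ y ∈ boxV n, connIn (T : Set (Sym2 V4)) x y) ∧
    T.card + 1 = (boxV n).card

/-- The number of spanning trees of the box `[-n,n]⁴` containing a given edge set `E`. -/
def treeCount (n : ℕ) (E : Finset (Sym2 V4)) : ℕ :=
  ((boxEdges n).powerset.filter fun T => IsBoxSpanningTree n T ∧ E ⊆ T).card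

/-- `𝔗` is distributed (under `P`) as the uniform spanning tree of `ℤ⁴`, i.e. as the
infinite-volume limit of the uniform spanning trees of the boxes `[-n,n]⁴` (Pemantle). -/
def IsUST4 {Ω : Type*} [MeasurableSpace Ω] (P : Measure Ω) (𝔗 : Ω → Set (Sym2 V4)) : Prop :=
  IsProbabilityMeasure P ∧
  (∀ e : Sym2 V4, MeasurableSet {ω | e ∈ 𝔗 ω}) ∧
  ∀ E : Finset (Sym2 V4),
    Tendsto (fun n => (treeCount n E : ℝ) / (treeCount n ∅ : ℝ)) atTop
      (𝓝 (P {ω | (E : Set (Sym2 V4)) ⊆ 𝔗 ω}).toReal)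

/-- The graph on `ℤ⁴` whose edges are the elements of `T`. -/
def treeGraph (T : Set (Sym2 V4)) : SimpleGraph V4 := SimpleGraph.fromEdgeSet T

/-- The intrinsic (graph) distance in `T`. -/
def treeDist (T : Set (Sym2 V4)) (x y : V4) : ℕ := (treeGraph T).dist x y

/-- The intrinsic ball of radius `n` around `x` in `T`. -/
def treeBall (T : Set (Sym2 V4)) (x : V4) (n : ℕ) : Set V4 :=
  {y | (treeGraph T).Reachable x y ∧ treeDist T x y ≤ n}

/-- The `ℓ∞` ball of (real) radius `r` around `x` in `ℤ⁴`. -/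
def boxR (x : V4) (r : ℝ) : Set V4 := {y | ∀ i, |(y i : ℝ) - (x i : ℝ)| ≤ r}


/-- The `ℓ∞` norm of a vertex of `ℤ⁴`. -/
def extNorm (x : V4) : ℕ := Finset.univ.sup fun i => (x i).natAbs

/-- The event that `T` contains a path from `∂Λ(r)` to `∂Λ(4r)` of length at most `n`. -/
def crossEvent (T : Set (Sym2 V4)) (r n : ℕ) : Prop :=
  ∃ (m : ℕ) (p : ℕ → V4), m ≤ n ∧ extNorm (p 0) = r ∧ extNorm (p m) = 4 * r ∧
    ∀ k < m, s(p k, p (k + 1)) ∈ T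

/-! ### Weighted Laplacians with Dirichlet conditions -/

/-- The Laplacian of the network with conductances `c`. -/
def netLap {V : Type*} [Fintype V] (c : V → V → ℝ) (h : V → ℝ) (u : V) : ℝ :=
  ∑ w, c u w * (h u - h w)

/-- The Dirichlet energy of the network with conductances `c`. -/
def netEnergy {V : Type*} [Fintype V] (c : V → V → ℝ) (h : V → ℝ) : ℝ :=
  (∑ u, ∑ w, c u w * (h u - h w) ^ 2) / 2

/-- The Laplacian matrix whose rows indexed by `A` are replaced by rows of the identity. -/
def dirMat {V : Type*} [Fintype V] [DecidableEq V] (c : V → V → ℝ) (A : Finset V) :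
    Matrix V V ℝ :=
  fun u w => if u ∈ A then (if u = w then 1 else 0) else (if u = w then ∑ z, c u z else 0) - c u w

/-- A function that vanishes on `A` and has no energy is zero. -/
def NetNondeg {V : Type*} [Fintype V] (c : V → V → ℝ) (A : Finset V) : Prop :=
  ∀ h : V → ℝ, (∀ u ∈ A, h u = 0) → netEnergy c h = 0 → h = 0

/-- The Green function with pole `v` and Dirichlet condition on `A`. -/
def netGreen {V : Type*} [Fintype V] [DecidableEq V] (c : V → V → ℝ) (A : Finset V) (v : V) :
    V → ℝ :=
  (dirMat c A)⁻¹.mulVec (Pi.single v 1)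

section Network

variable {V : Type*} [Fintype V] {c : V → V → ℝ}

theorem sum_mul_netLap (hc : ∀ u w, c u w = c w u) (g h : V → ℝ) :
    ∑ u, g u * netLap c h u = (∑ u, ∑ w, c u w * ((g u - g w) * (h u - h w))) / 2 := by
  have h1 : ∑ u, g u * netLap c h u = ∑ u, ∑ w, c u w * (g u * (h u - h w)) := by
    refine Finset.sum_congr rfl fun u _ => ?_
    rw [netLap, Finset.mul_sum]
    exact Finset.sum_congr rfl fun w _ => by ring
  have h2 : ∑ u, ∑ w, c u w * (g u * (h u - h w)) = ∑ u, ∑ w, c u w * (g w * (h w - h u)) := by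
    rw [Finset.sum_comm]
    exact Finset.sum_congr rfl fun u _ => Finset.sum_congr rfl fun w _ => by rw [hc]
  have h3 : ∑ u, ∑ w, c u w * ((g u - g w) * (h u - h w))
      = ∑ u, ∑ w, c u w * (g u * (h u - h w)) + ∑ u, ∑ w, c u w * (g w * (h w - h u)) := by
    simp only [← Finset.sum_add_distrib]
    exact Finset.sum_congr rfl fun u _ => Finset.sum_congr rfl fun w _ => by ring
  rw [h3, ← h2, h1]; ring

theorem sum_mul_netLap_self (hc : ∀ u w, c u w = c w u) (h : V → ℝ) :
    ∑ u, h u * netLap c h u = netEnergy c h := by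
  rw [sum_mul_netLap hc, netEnergy]
  simp only [sq]

theorem netEnergy_nonneg (h0 : ∀ u w, 0 ≤ c u w) (h : V → ℝ) : 0 ≤ netEnergy c h := by
  unfold netEnergy
  exact div_nonneg (Finset.sum_nonneg fun u _ => Finset.sum_nonneg fun w _ =>
    mul_nonneg (h0 u w) (sq_nonneg _)) (by norm_num)

theorem netEnergy_add (hc : ∀ u w, c u w = c w u) (g h : V → ℝ) :
    netEnergy c (g + h) = netEnergy c g + 2 * ∑ u, g u * netLap c h u + netEnergy c h := by
  rw [sum_mul_netLap hc]
  simp only [netEnergy, Pi.add_apply]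
  have : ∑ u, ∑ w, c u w * (g u + h u - (g w + h w)) ^ 2 = ∑ u, ∑ w, c u w * (g u - g w) ^ 2
      + 2 * (∑ u, ∑ w, c u w * ((g u - g w) * (h u - h w)))
      + ∑ u, ∑ w, c u w * (h u - h w) ^ 2 := by
    simp only [Finset.mul_sum, ← Finset.sum_add_distrib]
    exact Finset.sum_congr rfl fun u _ => Finset.sum_congr rfl fun w _ => by ring
  rw [this]; ring

theorem netEnergy_smul (a : ℝ) (h : V → ℝ) : netEnergy c (a • h) = a ^ 2 * netEnergy c h := by
  simp only [netEnergy, Pi.smul_apply, smul_eq_mul]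
  rw [← mul_div_assoc, Finset.mul_sum]
  congr 1
  refine Finset.sum_congr rfl fun u _ => ?_
  rw [Finset.mul_sum]
  exact Finset.sum_congr rfl fun w _ => by ring

theorem netLap_eq_zero_of_netEnergy_eq_zero (hc : ∀ u w, 0 ≤ c u w) {h : V → ℝ}
    (he : netEnergy c h = 0) (u : V) : netLap c h u = 0 := by
  have h1 : ∑ u, ∑ w, c u w * (h u - h w) ^ 2 = 0 := by
    unfold netEnergy at he; linarith
  rw [Finset.sum_eq_zero_iff_of_nonneg
    (fun u _ => Finset.sum_nonneg fun w _ => mul_nonneg (hc u w) (sq_nonneg _))] at h1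
  have h2 := h1 u (Finset.mem_univ u)
  rw [Finset.sum_eq_zero_iff_of_nonneg
    (fun w _ => mul_nonneg (hc u w) (sq_nonneg _))] at h2
  refine Finset.sum_eq_zero fun w _ => ?_
  rcases mul_eq_zero.1 (h2 w (Finset.mem_univ w)) with h3 | h3
  · simp [h3]
  · simp [pow_eq_zero_iff (two_ne_zero) |>.1 h3]

theorem NetNondeg.mono {A B : Finset V} (h : NetNondeg c A) (hAB : A ⊆ B) : NetNondeg c B :=
  fun g hg he => h g (fun u hu => hg u (hAB hu)) he

variable [DecidableEq V] {A : Finset V}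

theorem dirMat_mulVec (h : V → ℝ) (u : V) :
    (dirMat c A).mulVec h u = if u ∈ A then h u else netLap c h u := by
  simp only [Matrix.mulVec, dotProduct, dirMat, netLap]
  split_ifs with hu
  · simp
  · simp [sub_mul, mul_sub, Finset.sum_sub_distrib, Finset.sum_mul]

theorem dirMat_insert (v : V) :
    dirMat c (insert v A) = (dirMat c A).updateRow v (Pi.single v 1) := by
  ext u w
  rw [Matrix.updateRow_apply]
  by_cases h : u = v
  · subst h
    simp [dirMat, Pi.single_apply, eq_comm]
  · simp [dirMat, h]

theorem dirMat_univ : dirMat c (Finset.univ : Finset V) = 1 := by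
  ext u w
  simp [dirMat, Matrix.one_apply]

theorem NetNondeg.det_ne_zero (hc : ∀ u w, c u w = c w u) (h : NetNondeg c A) :
    (dirMat c A).det ≠ 0 := by
  intro hd
  obtain ⟨g, hg0, hg⟩ := Matrix.exists_mulVec_eq_zero_iff.2 hd
  have key := fun u => congrFun hg u
  simp only [dirMat_mulVec, Pi.zero_apply] at key
  have hA : ∀ u ∈ A, g u = 0 := fun u hu => by simpa [hu] using key u
  refine hg0 (h g hA ?_)
  rw [← sum_mul_netLap_self hc]
  refine Finset.sum_eq_zero fun u _ => ?_
  by_cases hu : u ∈ A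
  · simp [hA u hu]
  · have := key u
    simp only [hu, if_false] at this
    simp [this]

theorem dirMat_mulVec_netGreen (h : (dirMat c A).det ≠ 0) (v : V) :
    (dirMat c A).mulVec (netGreen c A v) = Pi.single v 1 := by
  rw [netGreen, Matrix.mulVec_mulVec, Matrix.mul_nonsing_inv _ (isUnit_iff_ne_zero.2 h),
    Matrix.one_mulVec]

theorem netGreen_eq (h : (dirMat c A).det ≠ 0) {v : V} {g : V → ℝ}
    (hg : (dirMat c A).mulVec g = Pi.single v 1) : g = netGreen c A v := by
  rw [netGreen, ← hg, Matrix.mulVec_mulVec, Matrix.nonsing_inv_mul _ (isUnit_iff_ne_zero.2 h),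
    Matrix.one_mulVec]

theorem netGreen_of_mem (h : (dirMat c A).det ≠ 0) {u v : V} (hv : v ∉ A) (hu : u ∈ A) :
    netGreen c A v u = 0 := by
  have := congrFun (dirMat_mulVec_netGreen h v) u
  rw [dirMat_mulVec, if_pos hu] at this
  rw [this, Pi.single_apply, if_neg]
  rintro rfl; exact hv hu

theorem netLap_netGreen (h : (dirMat c A).det ≠ 0) {u v : V} (hu : u ∉ A) :
    netLap c (netGreen c A v) u = if u = v then 1 else 0 := by
  have := congrFun (dirMat_mulVec_netGreen h v) u
  rwa [dirMat_mulVec, if_neg hu, Pi.single_apply] at this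

theorem det_dirMat_insert (h : (dirMat c A).det ≠ 0) (v : V) :
    (dirMat c (insert v A)).det = netGreen c A v v * (dirMat c A).det := by
  rw [dirMat_insert, ← Matrix.adjugate_apply, netGreen, Matrix.mulVec_single_one, Matrix.col_apply,
    Matrix.inv_def, Matrix.smul_apply, Ring.inverse_eq_inv', smul_eq_mul]
  field_simp

theorem sum_mul_netLap_netGreen (h : (dirMat c A).det ≠ 0) {v : V} (hv : v ∉ A) {g : V → ℝ}
    (hg : ∀ u ∈ A, g u = 0) : ∑ u, g u * netLap c (netGreen c A v) u = g v := by
  rw [Finset.sum_eq_single v]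
  · rw [netLap_netGreen h hv]; simp
  · intro u _ huv
    by_cases hu : u ∈ A
    · simp [hg u hu]
    · rw [netLap_netGreen h hu]; simp [huv]
  · simp

theorem netEnergy_netGreen (hc : ∀ u w, c u w = c w u) (h : (dirMat c A).det ≠ 0) {v : V}
    (hv : v ∉ A) : netEnergy c (netGreen c A v) = netGreen c A v v := by
  rw [← sum_mul_netLap_self hc, sum_mul_netLap_netGreen h hv]
  exact fun u hu => netGreen_of_mem h hv hu

theorem netGreen_self_pos (hc : ∀ u w, c u w = c w u) (h0 : ∀ u w, 0 ≤ c u w)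
    (h : NetNondeg c A) {v : V} (hv : v ∉ A) : 0 < netGreen c A v v := by
  have hd := h.det_ne_zero hc
  rw [← netEnergy_netGreen hc hd hv]
  refine lt_of_le_of_ne (netEnergy_nonneg h0 _) fun he => ?_
  have hz : netGreen c A v = 0 := h _ (fun u hu => netGreen_of_mem hd hv hu) he.symm
  have h2 := netLap_netGreen (v := v) hd hv
  rw [hz] at h2
  simp [netLap] at h2

/-- Dirichlet's principle: the Green function on the diagonal is an effective resistance. -/
theorem sq_le_netGreen_mul_netEnergy (hc : ∀ u w, c u w = c w u) (h0 : ∀ u w, 0 ≤ c u w)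
    (h : NetNondeg c A) {v : V} (hv : v ∉ A) {g : V → ℝ} (hg : ∀ u ∈ A, g u = 0) :
    g v ^ 2 ≤ netGreen c A v v * netEnergy c g := by
  have hd := h.det_ne_zero hc
  have hR := netGreen_self_pos hc h0 h hv
  set R := netGreen c A v v with hRdef
  have key : 0 ≤ netEnergy c (g + (-(g v / R)) • netGreen c A v) := netEnergy_nonneg h0 _
  have hlap : ∀ u, netLap c ((-(g v / R)) • netGreen c A v) u
      = (-(g v / R)) * netLap c (netGreen c A v) u := by
    intro u
    simp only [netLap, Finset.mul_sum, Pi.smul_apply, smul_eq_mul]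
    exact Finset.sum_congr rfl fun w _ => by ring
  rw [netEnergy_add hc, netEnergy_smul, netEnergy_netGreen hc hd hv] at key
  have h2 : ∑ u, g u * netLap c ((-(g v / R)) • netGreen c A v) u = -(g v / R) * g v := by
    have h3 : ∑ u, g u * netLap c ((-(g v / R)) • netGreen c A v) u
        = -(g v / R) * ∑ u, g u * netLap c (netGreen c A v) u := by
      rw [Finset.mul_sum]
      exact Finset.sum_congr rfl fun u _ => by rw [hlap]; ring
    rw [h3, sum_mul_netLap_netGreen hd hv hg]
  rw [h2, ← hRdef] at key
  have h3 : netEnergy c g + 2 * (-(g v / R) * g v) + (-(g v / R)) ^ 2 * R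
      = netEnergy c g - g v ^ 2 / R := by field_simp; ring
  rw [h3] at key
  have : g v ^ 2 / R ≤ netEnergy c g := by linarith
  rw [div_le_iff₀ hR] at this
  linarith

theorem det_dirMat_pos (hc : ∀ u w, c u w = c w u) (h0 : ∀ u w, 0 ≤ c u w)
    (h : NetNondeg c A) : 0 < (dirMat c A).det := by
  induction hn : (Finset.univ \ A).card generalizing A with
  | zero =>
    have : A = Finset.univ := by
      rw [Finset.card_eq_zero, Finset.sdiff_eq_empty_iff_subset] at hn
      exact Finset.univ_subset_iff.1 hn
    rw [this, dirMat_univ]; simp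
  | succ n ih =>
    obtain ⟨v, hv⟩ : (Finset.univ \ A).Nonempty := by
      rw [← Finset.card_pos, hn]; omega
    have hvA : v ∉ A := by simpa using hv
    have h1 := ih (h.mono (Finset.subset_insert v A)) (by
      rw [Finset.sdiff_insert, Finset.card_erase_of_mem hv, hn]; simp)
    rw [det_dirMat_insert (h.det_ne_zero hc)] at h1
    exact (pos_iff_pos_of_mul_pos h1).1 (netGreen_self_pos hc h0 h hvA)

/-- An upper bound on a determinant ratio from a bound on the effective resistance. -/
theorem det_dirMat_insert_le (hc : ∀ u w, c u w = c w u)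
    (hpos : 0 ≤ (dirMat c A).det) {v : V} (hv : v ∉ A) {b : ℝ} (hb : 0 ≤ b)
    (H : ∀ g : V → ℝ, (∀ u ∈ A, g u = 0) → g v ^ 2 ≤ b * netEnergy c g) :
    (dirMat c (insert v A)).det ≤ b * (dirMat c A).det := by
  rcases hpos.eq_or_lt with hd | hd
  · obtain ⟨g, hg0, hg⟩ := Matrix.exists_mulVec_eq_zero_iff.2 hd.symm
    have key := fun u => congrFun hg u
    simp only [dirMat_mulVec, Pi.zero_apply] at key
    have hA : ∀ u ∈ A, g u = 0 := fun u hu => by simpa [hu] using key u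
    have hz : ∀ u ∉ A, netLap c g u = 0 := fun u hu => by simpa [hu] using key u
    have he : netEnergy c g = 0 := by
      rw [← sum_mul_netLap_self hc]
      refine Finset.sum_eq_zero fun u _ => ?_
      by_cases hu : u ∈ A
      · simp [hA u hu]
      · simp [hz u hu]
    have hgv : g v = 0 := by
      have := H g hA
      rw [he, mul_zero] at this
      exact pow_eq_zero_iff two_ne_zero |>.1 (le_antisymm this (sq_nonneg _))
    have : (dirMat c (insert v A)).det = 0 := by
      refine Matrix.exists_mulVec_eq_zero_iff.1 ⟨g, hg0, ?_⟩
      ext u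
      rw [dirMat_mulVec]
      split_ifs with hu
      · rcases Finset.mem_insert.1 hu with rfl | hu
        · exact hgv
        · exact hA u hu
      · exact hz u fun h => hu (Finset.mem_insert_of_mem h)
    rw [this, ← hd, mul_zero]
  · rw [det_dirMat_insert hd.ne']
    refine mul_le_mul_of_nonneg_right ?_ hd.le
    have h1 := H _ (fun u hu => netGreen_of_mem hd.ne' hv hu)
    rw [netEnergy_netGreen hc hd.ne' hv] at h1
    by_contra! hlt
    nlinarith

/-- First-step decomposition of the Green function at the last exit from `u`. -/
theorem netGreen_step {u y : V} (h : (dirMat c A).det ≠ 0)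
    (h' : (dirMat c (insert u A)).det ≠ 0) (hu : u ∉ A) (hy : y ∉ insert u A) :
    netGreen c A y u = netGreen c A u u * ∑ w, c u w * netGreen c (insert u A) y w := by
  set f := netGreen c (insert u A) y with hf
  set κ := ∑ w, c u w * f w with hκ
  have hfu : f u = 0 := netGreen_of_mem h' hy (Finset.mem_insert_self u A)
  have hyu : y ≠ u := fun e => hy (e ▸ Finset.mem_insert_self _ _)
  have hyA : y ∉ A := fun e => hy (Finset.mem_insert_of_mem e)
  have : f + κ • netGreen c A u = netGreen c A y := by
    refine netGreen_eq h ?_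
    rw [Matrix.mulVec_add, Matrix.mulVec_smul, dirMat_mulVec_netGreen h]
    ext w
    simp only [Pi.add_apply, Pi.smul_apply, smul_eq_mul, dirMat_mulVec]
    by_cases hw : w ∈ A
    · have h1 : f w = 0 := netGreen_of_mem h' hy (Finset.mem_insert_of_mem hw)
      have h2 : w ≠ u := fun e => hu (e ▸ hw)
      have h3 : w ≠ y := fun e => hyA (e ▸ hw)
      simp [hw, h1, h2, h3]
    · rw [if_neg hw]
      by_cases hwu : w = u
      · subst hwu
        have : netLap c f w = -κ := by
          simp only [netLap, hfu, hκ, zero_sub, mul_neg, Finset.sum_neg_distrib]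
        simp [this, Ne.symm hyu]
      · rw [netLap_netGreen h' (by simp [hw, hwu])]
        simp [hwu, Pi.single_apply]
  rw [← this]
  simp [hfu, mul_comm]

/-- The Green function is nonnegative. -/
theorem netGreen_nonneg (hc : ∀ u w, c u w = c w u) (h0 : ∀ u w, 0 ≤ c u w)
    (h : NetNondeg c A) {v : V} (hv : v ∉ A) (u : V) : 0 ≤ netGreen c A v u := by
  have hd := h.det_ne_zero hc
  set f := netGreen c A v with hf
  have hR := (netGreen_self_pos hc h0 h hv).le
  set g : V → ℝ := fun u => |f u| with hg
  have hfA : ∀ u ∈ A, f u = 0 := fun u hu => netGreen_of_mem hd hv hu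
  have hgA : ∀ u ∈ A, g u = 0 := fun u hu => by simp [hg, hfA u hu]
  have hE : netEnergy c g ≤ netEnergy c f := by
    unfold netEnergy
    refine div_le_div_of_nonneg_right (Finset.sum_le_sum fun u _ => Finset.sum_le_sum fun w _ =>
      mul_le_mul_of_nonneg_left ?_ (h0 u w)) (by norm_num)
    exact sq_le_sq.2 (abs_abs_sub_abs_le_abs_sub (f u) (f w))
  have h1 := netEnergy_add hc g ((-1 : ℝ) • f)
  have hlap : ∀ u, netLap c ((-1 : ℝ) • f) u = (-1) * netLap c f u := by
    intro u
    simp only [netLap, Finset.mul_sum, Pi.smul_apply, smul_eq_mul]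
    exact Finset.sum_congr rfl fun w _ => by ring
  have h2 : ∑ u, g u * netLap c ((-1 : ℝ) • f) u = - g v := by
    rw [← sum_mul_netLap_netGreen hd hv hgA, ← Finset.sum_neg_distrib]
    exact Finset.sum_congr rfl fun u _ => by rw [hlap]; ring
  have hgv : g v = f v := abs_of_nonneg hR
  rw [h2, netEnergy_smul, hgv] at h1
  have h3 := netEnergy_netGreen hc hd hv
  rw [← hf] at h3
  have h4 : netEnergy c (g + (-1 : ℝ) • f) = 0 :=
    le_antisymm (by rw [h1]; linarith) (netEnergy_nonneg h0 _)
  have h5 := h _ (fun u hu => by simp [hgA u hu, hfA u hu]) h4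
  have h6 := congrFun h5 u
  simp only [Pi.add_apply, Pi.smul_apply, smul_eq_mul, Pi.zero_apply, hg] at h6
  have : f u = |f u| := by linarith
  rw [this]; exact abs_nonneg _

end Network

/-! ### The matrix-tree theorem for rooted forests -/

/-- Unit conductances on the edges of `B` between vertices of `S`. -/
def edgeCond (S : Finset V4) (B : Finset (Sym2 V4)) (u w : S) : ℝ :=
  if s((u : V4), (w : V4)) ∈ B then 1 else 0

theorem edgeCond_comm {S : Finset V4} {B : Finset (Sym2 V4)} (u w : S) :
    edgeCond S B u w = edgeCond S B w u := by
  rw [edgeCond, edgeCond, Sym2.eq_swap]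

theorem edgeCond_nonneg {S : Finset V4} {B : Finset (Sym2 V4)} (u w : S) :
    0 ≤ edgeCond S B u w := by
  unfold edgeCond; split_ifs <;> norm_num

/-- `F` is a spanning forest of `S` in which each tree contains exactly one element of `A`. -/
def IsRootedForest (S : Finset V4) (A : Finset S) (F : Finset (Sym2 V4)) : Prop :=
  (∀ x ∈ S, ∃ a ∈ A, connIn (F : Set (Sym2 V4)) x a) ∧ F.card + A.card = S.card

/-- The number of spanning forests of `S` rooted at `A` with edges in `B`. -/
def forestCount (S : Finset V4) (B : Finset (Sym2 V4)) (A : Finset S) : ℕ :=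
  (B.powerset.filter fun F => IsRootedForest S A F).card

theorem connIn_mono {T T' : Set (Sym2 V4)} (h : T ⊆ T') {x y : V4} (hxy : connIn T x y) :
    connIn T' x y :=
  Relation.ReflTransGen.mono (p := fun a b => s(a, b) ∈ T') (fun _ _ hab => h hab) x y hxy

theorem connIn_symm {T : Set (Sym2 V4)} {x y : V4} (hxy : connIn T x y) : connIn T y x := by
  induction hxy with
  | refl => exact Relation.ReflTransGen.refl
  | tail _ hbc ih => exact Relation.ReflTransGen.head (by rwa [Sym2.eq_swap]) ih

theorem isRootedForest_insert {S : Finset V4} {A : Finset S} {F : Finset (Sym2 V4)} {a v : S}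
    (ha : a ∈ A) (hv : v ∉ A) (he : s((a : V4), (v : V4)) ∉ F) :
    IsRootedForest S A (insert s((a : V4), (v : V4)) F) ↔ IsRootedForest S (insert v A) F := by
  unfold IsRootedForest
  rw [Finset.card_insert_of_notMem he, Finset.card_insert_of_notMem hv]
  refine and_congr ⟨fun h x hx => ?_, fun h x hx => ?_⟩ (by omega)
  · obtain ⟨b, hb, hxb⟩ := h x hx
    clear hx
    induction hxb using Relation.ReflTransGen.head_induction_on with
    | refl => exact ⟨b, Finset.mem_insert_of_mem hb, Relation.ReflTransGen.refl⟩
    | @head x z hxz _ ih =>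
      rw [Finset.coe_insert, Set.mem_insert_iff] at hxz
      rcases hxz with hxz | hxz
      · rcases Sym2.eq_iff.1 hxz with ⟨rfl, -⟩ | ⟨rfl, -⟩
        · exact ⟨a, Finset.mem_insert_of_mem ha, Relation.ReflTransGen.refl⟩
        · exact ⟨v, Finset.mem_insert_self _ _, Relation.ReflTransGen.refl⟩
      · obtain ⟨b', hb', h'⟩ := ih
        exact ⟨b', hb', Relation.ReflTransGen.head hxz h'⟩
  · obtain ⟨b, hb, hxb⟩ := h x hx
    have hxb' : connIn (insert s((a : V4), (v : V4)) F : Finset (Sym2 V4)) x b :=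
      connIn_mono (by simp) hxb
    rcases Finset.mem_insert.1 hb with rfl | hb
    · refine ⟨a, ha, Relation.ReflTransGen.tail hxb' ?_⟩
      rw [Sym2.eq_swap]; simp
    · exact ⟨b, hb, hxb'⟩

theorem forestCount_eq_add {S : Finset V4} {B : Finset (Sym2 V4)} {A : Finset S} {a v : S}
    (ha : a ∈ A) (hv : v ∉ A) (he : s((a : V4), (v : V4)) ∈ B) :
    forestCount S B A = forestCount S (B.erase s((a : V4), (v : V4))) A
      + forestCount S (B.erase s((a : V4), (v : V4))) (insert v A) := by
  set e := s((a : V4), (v : V4)) with hedef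
  unfold forestCount
  rw [← Finset.card_filter_add_card_filter_not (s := B.powerset.filter _) (fun F => e ∉ F)]
  congr 1
  · congr 1
    ext F
    simp only [Finset.mem_filter, Finset.mem_powerset, Finset.subset_erase]
    tauto
  · refine Finset.card_bij' (fun F _ => F.erase e) (fun F _ => insert e F) ?_ ?_ ?_ ?_
    · intro F hF
      simp only [Finset.mem_filter, Finset.mem_powerset, not_not] at hF ⊢
      refine ⟨Finset.erase_subset_erase _ hF.1.1, ?_⟩
      rw [← isRootedForest_insert ha hv (by simp [hedef]), ← hedef, Finset.insert_erase hF.2]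
      exact hF.1.2
    · intro F hF
      simp only [Finset.mem_filter, Finset.mem_powerset, not_not, Finset.subset_erase] at hF ⊢
      refine ⟨⟨Finset.insert_subset he hF.1.1, ?_⟩, Finset.mem_insert_self _ _⟩
      rw [isRootedForest_insert ha hv hF.1.2]
      exact hF.2
    · intro F hF
      simp only [Finset.mem_filter, not_not] at hF
      exact Finset.insert_erase hF.2
    · intro F hF
      simp only [Finset.mem_filter, Finset.mem_powerset, Finset.subset_erase] at hF
      exact Finset.erase_insert hF.1.2

theorem det_dirMat_edgeCond_eq_add {S : Finset V4} {B : Finset (Sym2 V4)} {A : Finset S} {a v : S}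
    (ha : a ∈ A) (hv : v ∉ A) (he : s((a : V4), (v : V4)) ∈ B) :
    (dirMat (edgeCond S B) A).det
      = (dirMat (edgeCond S (B.erase s((a : V4), (v : V4)))) A).det
        + (dirMat (edgeCond S (B.erase s((a : V4), (v : V4)))) (insert v A)).det := by
  set e := s((a : V4), (v : V4)) with hedef
  set M := dirMat (edgeCond S (B.erase e)) A with hM
  have hva : v ≠ a := fun h => hv (h ▸ ha)
  have hrow : ∀ z, edgeCond S B v z = edgeCond S (B.erase e) v z + if z = a then 1 else 0 := by
    intro z
    unfold edgeCond
    by_cases hz : z = a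
    · subst hz
      have : s((v : V4), (z : V4)) = e := Sym2.eq_swap
      simp [this, he]
    · have : s((v : V4), (z : V4)) ≠ e := by
        intro h
        rcases Sym2.eq_iff.1 h with ⟨h1, -⟩ | ⟨-, h1⟩
        · exact hva (Subtype.ext h1)
        · exact hz (Subtype.ext h1)
      simp [this, hz]
  have hrow' : ∀ u ∉ A, u ≠ v → ∀ z, edgeCond S B u z = edgeCond S (B.erase e) u z := by
    intro u hu huv z
    unfold edgeCond
    have : s((u : V4), (z : V4)) ≠ e := by
      intro h
      rcases Sym2.eq_iff.1 h with ⟨h1, -⟩ | ⟨h1, -⟩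
      · exact hu (Subtype.ext h1 ▸ ha)
      · exact huv (Subtype.ext h1)
    simp [this]
  have hmat : dirMat (edgeCond S B) A
      = M.updateRow v (M v + (Pi.single v 1 + (-1 : ℝ) • Pi.single a 1)) := by
    ext u w
    rw [Matrix.updateRow_apply]
    by_cases huv : u = v
    · subst huv
      simp only [if_true, hM, dirMat, hv, if_false, Pi.add_apply, Pi.smul_apply, smul_eq_mul,
        Pi.single_apply, hrow, Finset.sum_add_distrib, Finset.sum_ite_eq', Finset.mem_univ]
      by_cases h1 : u = w
      · subst h1
        simp [hva]; ring
      · simp only [h1, Ne.symm h1, if_false]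
        split_ifs <;> ring
    · rw [if_neg huv]
      by_cases hu : u ∈ A
      · simp [hM, dirMat, hu]
      · simp only [hM, dirMat, hu, if_false, hrow' u hu huv]
  have hzero : (M.updateRow v (Pi.single a 1)).det = 0 := by
    refine Matrix.det_zero_of_row_eq hva ?_
    ext w
    simp [Matrix.updateRow_apply, Ne.symm hva, hM, dirMat, ha, Pi.single_apply, eq_comm]
  rw [hmat, Matrix.det_updateRow_add, Matrix.det_updateRow_add, Matrix.det_updateRow_smul, hzero,
    Matrix.updateRow_eq_self, dirMat_insert]
  ring

/-- The matrix-tree theorem, for spanning forests rooted at `A`. -/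
theorem forestCount_eq_det {S : Finset V4} {B : Finset (Sym2 V4)} (A : Finset S)
    (hB : ∀ u w : V4, s(u, w) ∈ B → u ∈ S ∧ w ∈ S) :
    (forestCount S B A : ℝ) = (dirMat (edgeCond S B) A).det := by
  induction hn : B.card using Nat.strong_induction_on generalizing B A with
  | _ n ih =>
  by_cases hcross : ∃ a ∈ A, ∃ v ∉ A, s((a : V4), (v : V4)) ∈ B
  · obtain ⟨a, ha, v, hv, he⟩ := hcross
    have hlt : (B.erase s((a : V4), (v : V4))).card < n := hn ▸ Finset.card_erase_lt_of_mem he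
    have hB' : ∀ u w : V4, s(u, w) ∈ B.erase s((a : V4), (v : V4)) → u ∈ S ∧ w ∈ S :=
      fun u w h => hB u w (Finset.mem_of_mem_erase h)
    rw [forestCount_eq_add ha hv he, det_dirMat_edgeCond_eq_add ha hv he, Nat.cast_add,
      ih _ hlt A hB' rfl, ih _ hlt _ hB' rfl]
  · push Not at hcross
    by_cases hA : A = Finset.univ
    · subst hA
      rw [dirMat_univ, Matrix.det_one, forestCount, Nat.cast_eq_one, Finset.card_eq_one]
      refine ⟨∅, ?_⟩
      ext F
      simp only [Finset.mem_filter, Finset.mem_powerset, IsRootedForest, Finset.card_univ,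
        Fintype.card_coe, Nat.add_eq_right, Finset.card_eq_zero, Finset.mem_singleton]
      constructor
      · exact fun h => h.2.2
      · rintro rfl
        exact ⟨by simp, fun x hx => ⟨⟨x, hx⟩, by simp, Relation.ReflTransGen.refl⟩, rfl⟩
    · obtain ⟨x, hx⟩ : ∃ x, x ∉ A := by
        by_contra! h
        exact hA (Finset.eq_univ_iff_forall.2 h)
      have h1 : forestCount S B A = 0 := by
        rw [forestCount, Finset.card_eq_zero, Finset.filter_eq_empty_iff]
        rintro F hF ⟨hconn, -⟩
        rw [Finset.mem_powerset] at hF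
        obtain ⟨a, ha, hxa⟩ := hconn x x.2
        have : ∀ z : V4, connIn (F : Set (Sym2 V4)) x z → ∃ h : z ∈ S, (⟨z, h⟩ : S) ∉ A := by
          intro z hz
          induction hz with
          | refl => exact ⟨x.2, hx⟩
          | @tail b d _ hbd ih' =>
            obtain ⟨hbS, hbA⟩ := ih'
            have hmem := hF hbd
            refine ⟨(hB b d hmem).2, fun hdA => hcross _ hdA _ hbA ?_⟩
            rwa [Sym2.eq_swap]
        obtain ⟨_, h⟩ := this a hxa
        exact h ha
      have h2 : (dirMat (edgeCond S B) A).det = 0 := by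
        refine Matrix.exists_mulVec_eq_zero_iff.1 ⟨fun u => if u ∈ A then 0 else 1, ?_, ?_⟩
        · intro h
          simpa [hx] using congrFun h x
        · ext u
          rw [dirMat_mulVec]
          split_ifs with hu
          · rfl
          · refine Finset.sum_eq_zero fun w _ => ?_
            by_cases hw : w ∈ A
            · have : s((u : V4), (w : V4)) ∉ B := by
                rw [Sym2.eq_swap]; exact hcross w hw u hu
              simp [edgeCond, this]
            · simp [hu, hw]
      rw [h1, h2, Nat.cast_zero]

/-! ### A spectral bound on the discrete torus -/

/-- The characters of the discrete torus. -/
def torChar {m : ℕ} [NeZero m] (k x : Fin 4 → ZMod m) : ℂ :=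
  ∏ i, ZMod.stdAddChar (k i * x i)

/-- The Fourier transform on the discrete torus. -/
def torHat {m : ℕ} [NeZero m] (h : (Fin 4 → ZMod m) → ℝ) (k : Fin 4 → ZMod m) : ℂ :=
  ∑ x, (h x : ℂ) * torChar k x

/-- The Laplacian of the discrete torus. -/
def torLap {m : ℕ} (h : (Fin 4 → ZMod m) → ℝ) (x : Fin 4 → ZMod m) : ℝ :=
  ∑ i, ((h x - h (x + Pi.single i 1)) + (h x - h (x - Pi.single i 1)))

/-- The eigenvalues of the Laplacian of the discrete torus. -/
def torEig {m : ℕ} (k : Fin 4 → ZMod m) : ℝ :=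
  ∑ i, (2 - 2 * Real.cos (2 * Real.pi * (k i).valMinAbs / m))

/-- The sup norm on the discrete torus. -/
def torNorm {m : ℕ} (k : Fin 4 → ZMod m) : ℕ := Finset.univ.sup fun i => (k i).valMinAbs.natAbs

theorem torNorm_eq_zero {m : ℕ} {k : Fin 4 → ZMod m} : torNorm k = 0 ↔ k = 0 := by
  rw [torNorm, ← Nat.le_zero, Finset.sup_le_iff]
  simp [funext_iff]

section Torus

variable {m : ℕ} [NeZero m]

theorem torChar_add (k x y : Fin 4 → ZMod m) :
    torChar k (x + y) = torChar k x * torChar k y := by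
  simp only [torChar, Pi.add_apply, mul_add, AddChar.map_add_eq_mul, Finset.prod_mul_distrib]

theorem torChar_conj (k x : Fin 4 → ZMod m) :
    (starRingEnd ℂ) (torChar k x) = torChar k (-x) := by
  simp only [torChar, map_prod, Pi.neg_apply, mul_neg, AddChar.map_neg_eq_conj]

theorem norm_torChar (k x : Fin 4 → ZMod m) : ‖torChar k x‖ = 1 := by
  simp [torChar, norm_prod, AddChar.norm_apply]

theorem torChar_single (k : Fin 4 → ZMod m) (i : Fin 4) (a : ZMod m) :
    torChar k (Pi.single i a) = ZMod.stdAddChar (k i * a) := by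
  rw [torChar, Finset.prod_eq_single i]
  · simp
  · intro j _ hj; simp [hj]
  · simp

theorem sum_torChar (x : Fin 4 → ZMod m) :
    ∑ k, torChar k x = if x = 0 then (m : ℂ) ^ 4 else 0 := by
  simp only [torChar]
  rw [← Fintype.prod_sum (fun i (a : ZMod m) => (ZMod.stdAddChar (a * x i) : ℂ))]
  simp only [AddChar.sum_mulShift _ (ZMod.isPrimitive_stdAddChar m), ZMod.card]
  split_ifs with h
  · subst h; simp
  · obtain ⟨i, hi⟩ := Function.ne_iff.1 h
    exact Finset.prod_eq_zero (Finset.mem_univ i) (by simp [show x i ≠ 0 from hi])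

theorem sum_norm_sq_torHat (h : (Fin 4 → ZMod m) → ℝ) :
    ∑ k, ‖torHat h k‖ ^ 2 = (m : ℝ) ^ 4 * ∑ x, h x ^ 2 := by
  have h1 : ∀ k, ((‖torHat h k‖ ^ 2 : ℝ) : ℂ)
      = ∑ x, ∑ y, (h x : ℂ) * (h y : ℂ) * torChar k (x - y) := by
    intro k
    rw [← Complex.normSq_eq_norm_sq, ← Complex.mul_conj, torHat, map_sum, Finset.sum_mul_sum]
    refine Finset.sum_congr rfl fun x _ => Finset.sum_congr rfl fun y _ => ?_
    rw [map_mul, torChar_conj, Complex.conj_ofReal, sub_eq_add_neg, torChar_add]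
    ring
  have h2 : ((∑ k, ‖torHat h k‖ ^ 2 : ℝ) : ℂ) = (((m : ℝ) ^ 4 * ∑ x, h x ^ 2 : ℝ) : ℂ) := by
    rw [Complex.ofReal_sum, Finset.sum_congr rfl fun k _ => h1 k, Finset.sum_comm]
    rw [Complex.ofReal_mul, Complex.ofReal_sum, Finset.mul_sum]
    refine Finset.sum_congr rfl fun x _ => ?_
    rw [Finset.sum_comm, Finset.sum_eq_single x]
    · rw [← Finset.mul_sum, sum_torChar]; simp; ring
    · intro y _ hy
      rw [← Finset.mul_sum, sum_torChar, if_neg (sub_ne_zero.2 (Ne.symm hy)), mul_zero]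
    · simp
  exact_mod_cast h2

theorem torChar_single_add (k : Fin 4 → ZMod m) (i : Fin 4) :
    torChar k (Pi.single i 1) + torChar k (-Pi.single i 1)
      = ((2 * Real.cos (2 * Real.pi * (k i).valMinAbs / m) : ℝ) : ℂ) := by
  rw [← Pi.single_neg, torChar_single, torChar_single, mul_one, mul_neg, mul_one]
  have h1 : k i = (((k i).valMinAbs : ℤ) : ZMod m) := (ZMod.coe_valMinAbs _).symm
  have h2 : -k i = ((-(k i).valMinAbs : ℤ) : ZMod m) := by
    rw [Int.cast_neg, ← h1]
  rw [h2]
  generalize (k i).valMinAbs = j at h1 ⊢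
  rw [h1, ZMod.stdAddChar_coe, ZMod.stdAddChar_coe]
  push_cast
  rw [Complex.two_cos]
  congr 2 <;> ring

theorem torHat_torLap (h : (Fin 4 → ZMod m) → ℝ) (k : Fin 4 → ZMod m) :
    torHat (torLap h) k = (torEig k : ℂ) * torHat h k := by
  have hshift : ∀ e : Fin 4 → ZMod m, ∑ x, (h (x + e) : ℂ) * torChar k x
      = torChar k (-e) * torHat h k := by
    intro e
    rw [torHat, Finset.mul_sum]
    refine Fintype.sum_equiv (Equiv.addRight e) _ _ fun x => ?_
    have : torChar k x = torChar k (-e) * torChar k (x + e) := by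
      rw [← torChar_add]; congr 1; abel
    rw [this, Equiv.coe_addRight]; ring
  have h1 : torHat (torLap h) k = ∑ i : Fin 4, (2 * torHat h k
      - (torChar k (-Pi.single i 1) * torHat h k + torChar k (Pi.single i 1) * torHat h k)) := by
    have h2 : ∀ i : Fin 4, 2 * torHat h k
        - (torChar k (-Pi.single i 1) * torHat h k + torChar k (Pi.single i 1) * torHat h k)
        = ∑ x, (((h x - h (x + Pi.single i 1)) + (h x - h (x - Pi.single i 1)) : ℝ) : ℂ)
          * torChar k x := by
      intro i
      have h3 := hshift (Pi.single i 1)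
      have h4 := hshift (-Pi.single i 1)
      rw [neg_neg] at h4
      rw [← h3, ← h4, torHat, Finset.mul_sum, ← Finset.sum_add_distrib, ← Finset.sum_sub_distrib]
      refine Finset.sum_congr rfl fun x _ => ?_
      rw [sub_eq_add_neg x]
      push_cast
      ring
    rw [Finset.sum_congr rfl fun i _ => h2 i, Finset.sum_comm, torHat]
    refine Finset.sum_congr rfl fun x _ => ?_
    rw [← Finset.sum_mul, torLap, Complex.ofReal_sum]
  rw [h1, torEig, Complex.ofReal_sum, Finset.sum_mul]
  refine Finset.sum_congr rfl fun i _ => ?_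
  have := torChar_single_add k i
  rw [← add_mul, add_comm, this]
  push_cast
  ring

theorem sixteen_mul_sq_le_torEig (k : Fin 4 → ZMod m) :
    16 * ((torNorm k : ℝ) / m) ^ 2 ≤ torEig k := by
  have hm : (0 : ℝ) < m := by exact_mod_cast Nat.pos_of_ne_zero (NeZero.ne m)
  have h0 : ∀ i, 16 * (((k i).valMinAbs.natAbs : ℝ) / m) ^ 2
      ≤ 2 - 2 * Real.cos (2 * Real.pi * (k i).valMinAbs / m) := by
    intro i
    have hb := ZMod.valMinAbs_mem_Ioc (k i)
    set j := (k i).valMinAbs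
    have hj : |(j : ℝ)| * 2 ≤ m := by
      have : |j| * 2 ≤ m := by
        have := hb.1; have := hb.2
        rcases abs_cases j with h | h <;> omega
      exact_mod_cast this
    have habs : |2 * Real.pi * j / m| ≤ Real.pi := by
      rw [abs_div, abs_mul, abs_mul, abs_of_pos hm, abs_of_pos Real.pi_pos, abs_two,
        div_le_iff₀ hm]
      nlinarith [Real.pi_pos]
    have := Real.cos_le_one_sub_mul_cos_sq habs
    have e : ((j.natAbs : ℕ) : ℝ) = |(j : ℝ)| := by rw [Nat.cast_natAbs, Int.cast_abs]
    rw [e, div_pow, sq_abs]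
    have e2 : 2 / Real.pi ^ 2 * (2 * Real.pi * j / m) ^ 2 = 8 * ((j : ℝ) ^ 2 / m ^ 2) := by
      field_simp; ring
    rw [e2] at this
    linarith
  obtain ⟨i, -, hi⟩ := Finset.exists_mem_eq_sup Finset.univ Finset.univ_nonempty
    (fun i => (k i).valMinAbs.natAbs)
  rw [torNorm, hi]
  refine (h0 i).trans ?_
  refine Finset.single_le_sum (f := fun i => 2 - 2 * Real.cos (2 * Real.pi * (k i).valMinAbs / m))
    (fun j _ => ?_) (Finset.mem_univ i)
  linarith [Real.cos_le_one (2 * Real.pi * (k j).valMinAbs / m)]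

theorem torNorm_le (k : Fin 4 → ZMod m) : torNorm k ≤ m / 2 :=
  Finset.sup_le fun i _ => ZMod.natAbs_valMinAbs_le (k i)

theorem card_torNorm_le (t : ℕ) :
    (Finset.univ.filter fun k : Fin 4 → ZMod m => torNorm k ≤ t).card ≤ (2 * t + 1) ^ 4 := by
  have h1 : (Finset.univ.filter fun k : Fin 4 → ZMod m => torNorm k ≤ t)
      ⊆ Fintype.piFinset fun _ => Finset.univ.filter fun a : ZMod m => a.valMinAbs.natAbs ≤ t := by
    intro k hk
    simpa [torNorm, Fintype.mem_piFinset] using hk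
  have h2 : (Finset.univ.filter fun a : ZMod m => a.valMinAbs.natAbs ≤ t).card ≤ 2 * t + 1 := by
    have : (Finset.Icc (-(t : ℤ)) t).card = 2 * t + 1 := by
      rw [Int.card_Icc]; omega
    rw [← this]
    refine Finset.card_le_card_of_injOn ZMod.valMinAbs (fun a ha => ?_)
      ZMod.injective_valMinAbs.injOn
    have : a.valMinAbs.natAbs ≤ t := by simpa using ha
    simp only [Finset.coe_Icc, Set.mem_Icc]
    omega
  calc _ ≤ _ := Finset.card_le_card h1
    _ ≤ (2 * t + 1) ^ 4 := by
      rw [Fintype.card_piFinset_const]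
      exact Nat.pow_le_pow_left h2 _

theorem inv_pow_four_le_layers (M s : ℕ) (hs : 1 ≤ s) (hsM : s ≤ M + 1) :
    1 / (s : ℝ) ^ 4 ≤ 1 / ((M : ℝ) + 1) ^ 4
      + ∑ t ∈ Finset.Icc 1 M, if s ≤ t then 4 / (t : ℝ) ^ 5 else 0 := by
  induction M with
  | zero =>
    have : s = 1 := by omega
    subst this; simp
  | succ M ih =>
    rw [Finset.sum_Icc_succ_top (by omega)]
    rcases Nat.lt_or_ge (M + 1) s with h | h
    · have : s = M + 2 := by omega
      subst this
      rw [Finset.sum_eq_zero]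
      · rw [if_neg (by omega)]; push_cast; ring_nf; rfl
      · intro t ht
        rw [if_neg]
        have := (Finset.mem_Icc.1 ht).2
        omega
    · have := ih h
      rw [if_pos h]
      have hx : (1 : ℝ) ≤ M + 1 := by linarith [Nat.cast_nonneg (α := ℝ) M]
      push_cast
      set x : ℝ := (M : ℝ) + 1
      have key : 1 / x ^ 4 ≤ 1 / (x + 1) ^ 4 + 4 / x ^ 5 := by
        have hx0 : 0 < x := by linarith
        rw [div_add_div _ _ (by positivity) (by positivity), div_le_div_iff₀ (by positivity)
          (by positivity)]
        have : 0 ≤ x ^ 4 * (10 * x ^ 3 + 20 * x ^ 2 + 15 * x + 4) := by positivity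
        nlinarith
      linarith

theorem sum_inv_torNorm_pow_le :
    ∑ k : Fin 4 → ZMod m, (if k = 0 then 0 else 1 / (torNorm k : ℝ) ^ 4)
      ≤ 340 * (1 + Real.log m) := by
  set M := m / 2 with hM
  have hm1 : 1 ≤ m := Nat.pos_of_ne_zero (NeZero.ne m)
  have hlog : 0 ≤ Real.log m := Real.log_natCast_nonneg m
  have h1 : ∀ k : Fin 4 → ZMod m, (if k = 0 then 0 else 1 / (torNorm k : ℝ) ^ 4)
      ≤ (if torNorm k ≤ M then 1 / ((M : ℝ) + 1) ^ 4 else 0)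
      + ∑ t ∈ Finset.Icc 1 M, if torNorm k ≤ t then 4 / (t : ℝ) ^ 5 else 0 := by
    intro k
    rw [if_pos (torNorm_le k)]
    split_ifs with hk
    · refine add_nonneg (by positivity) (Finset.sum_nonneg fun t _ => ?_)
      split_ifs <;> positivity
    · refine inv_pow_four_le_layers M _ ?_ ((torNorm_le k).trans (Nat.le_succ _))
      exact Nat.one_le_iff_ne_zero.2 fun h => hk (torNorm_eq_zero.1 h)
  refine (Finset.sum_le_sum fun k _ => h1 k).trans ?_
  rw [Finset.sum_add_distrib, Finset.sum_comm]
  have hcount : ∀ (t : ℕ) (b : ℝ), 0 ≤ b →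
      ∑ k : Fin 4 → ZMod m, (if torNorm k ≤ t then b else 0) ≤ (2 * (t : ℝ) + 1) ^ 4 * b := by
    intro t b hb
    rw [← Finset.sum_filter, Finset.sum_const, nsmul_eq_mul]
    refine mul_le_mul_of_nonneg_right ?_ hb
    exact_mod_cast card_torNorm_le (m := m) t
  have h2 : ∑ k : Fin 4 → ZMod m, (if torNorm k ≤ M then 1 / ((M : ℝ) + 1) ^ 4 else 0) ≤ 16 := by
    refine (hcount M _ (by positivity)).trans ?_
    rw [mul_one_div, div_le_iff₀ (by positivity)]
    have : (2 * (M : ℝ) + 1) ^ 4 ≤ (2 * ((M : ℝ) + 1)) ^ 4 := by gcongr; linarith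
    nlinarith
  have h3 : ∑ t ∈ Finset.Icc 1 M, ∑ k : Fin 4 → ZMod m,
      (if torNorm k ≤ t then 4 / (t : ℝ) ^ 5 else 0) ≤ 324 * (1 + Real.log m) := by
    have h4 : ∀ t ∈ Finset.Icc 1 M, ∑ k : Fin 4 → ZMod m,
        (if torNorm k ≤ t then 4 / (t : ℝ) ^ 5 else 0) ≤ 324 * (t : ℝ)⁻¹ := by
      intro t ht
      have ht1 : (1 : ℝ) ≤ t := by exact_mod_cast (Finset.mem_Icc.1 ht).1
      refine (hcount t _ (by positivity)).trans ?_
      have : (2 * (t : ℝ) + 1) ^ 4 ≤ (3 * (t : ℝ)) ^ 4 := by gcongr; linarith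
      calc (2 * (t : ℝ) + 1) ^ 4 * (4 / (t : ℝ) ^ 5) ≤ (3 * (t : ℝ)) ^ 4 * (4 / (t : ℝ) ^ 5) := by
            gcongr
        _ = 324 * (t : ℝ)⁻¹ := by field_simp; norm_num
    refine (Finset.sum_le_sum h4).trans ?_
    rw [← Finset.mul_sum]
    have h5 : ∑ t ∈ Finset.Icc 1 M, (t : ℝ)⁻¹ ≤ 1 + Real.log M := by
      have := harmonic_le_one_add_log M
      rw [harmonic_eq_sum_Icc] at this
      push_cast at this
      exact this
    have h6 : Real.log M ≤ Real.log m := by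
      rcases Nat.eq_zero_or_pos M with h | h
      · rw [h]; simpa using hlog
      · exact Real.log_le_log (by exact_mod_cast h) (by exact_mod_cast Nat.div_le_self m 2)
    linarith
  linarith

/-- A function on the torus is within logarithmic `ℓ²` distance of a constant, relative to the
`ℓ¹` norm of its Laplacian. -/
theorem exists_sum_sub_sq_le_torLap (h : (Fin 4 → ZMod m) → ℝ) :
    ∃ a : ℝ, ∑ x, (h x - a) ^ 2 ≤ 2 * (1 + Real.log m) * (∑ x, |torLap h x|) ^ 2 := by
  have hm : (0 : ℝ) < m := by exact_mod_cast Nat.pos_of_ne_zero (NeZero.ne m)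
  set τ := ∑ x, |torLap h x| with hτ
  set a := (∑ x, h x) / (m : ℝ) ^ 4 with ha
  refine ⟨a, ?_⟩
  set g : (Fin 4 → ZMod m) → ℝ := fun x => h x - a with hg
  have hlap : torLap g = torLap h := by
    ext x; simp [torLap, hg]
  have hzero : torHat g 0 = 0 := by
    have : torHat g 0 = ((∑ x, g x : ℝ) : ℂ) := by
      simp [torHat, torChar]
    rw [this, hg, Finset.sum_sub_distrib]
    simp [ha]
    field_simp
    simp
  have hk : ∀ k, ‖torHat g k‖ ^ 2 ≤
      τ ^ 2 * ((m : ℝ) ^ 4 / 256 * (if k = 0 then 0 else 1 / (torNorm k : ℝ) ^ 4)) := by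
    intro k
    by_cases hk0 : k = 0
    · subst hk0; simp [hzero]
    rw [if_neg hk0]
    have h1 : ‖torHat (torLap g) k‖ ≤ τ := by
      rw [hlap, hτ, torHat]
      refine (norm_sum_le _ _).trans (Finset.sum_le_sum fun x _ => ?_)
      rw [norm_mul, norm_torChar, mul_one, Complex.norm_real, Real.norm_eq_abs]
    have hs : (0 : ℝ) < torNorm k := by
      exact_mod_cast Nat.pos_of_ne_zero fun h => hk0 (torNorm_eq_zero.1 h)
    have h2 := sixteen_mul_sq_le_torEig k
    have h3 : 0 < 16 * ((torNorm k : ℝ) / m) ^ 2 := by positivity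
    rw [torHat_torLap, norm_mul, Complex.norm_real, Real.norm_eq_abs,
      abs_of_pos (h3.trans_le h2)] at h1
    have h4 : 16 * ((torNorm k : ℝ) / m) ^ 2 * ‖torHat g k‖ ≤ τ :=
      (mul_le_mul_of_nonneg_right h2 (norm_nonneg _)).trans h1
    have h5 : (16 * ((torNorm k : ℝ) / m) ^ 2 * ‖torHat g k‖) ^ 2 ≤ τ ^ 2 := by
      gcongr
    have h6 : ‖torHat g k‖ ^ 2 = (16 * ((torNorm k : ℝ) / m) ^ 2 * ‖torHat g k‖) ^ 2
        * ((m : ℝ) ^ 4 / 256 * (1 / (torNorm k : ℝ) ^ 4)) := by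
      field_simp; ring
    rw [h6]
    gcongr
  have hP := sum_norm_sq_torHat g
  have hS : ∑ k, ‖torHat g k‖ ^ 2 ≤ τ ^ 2 * ((m : ℝ) ^ 4 / 256 * (340 * (1 + Real.log m))) := by
    refine (Finset.sum_le_sum fun k _ => hk k).trans ?_
    rw [← Finset.mul_sum, ← Finset.mul_sum]
    have := sum_inv_torNorm_pow_le (m := m)
    gcongr
  rw [hP] at hS
  have hlog : 0 ≤ Real.log m := Real.log_natCast_nonneg m
  have h7 : (m : ℝ) ^ 4 * ∑ x, g x ^ 2 ≤ (m : ℝ) ^ 4 * (2 * (1 + Real.log m) * τ ^ 2) := by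
    refine hS.trans ?_
    have : 0 ≤ τ ^ 2 * (m : ℝ) ^ 4 * (1 + Real.log m) := by positivity
    nlinarith
  exact le_of_mul_le_mul_left h7 (by positivity)

end Torus

/-! ### The Laplacian of a box -/

theorem mem_boxV {N : ℕ} {x : V4} : x ∈ boxV N ↔ ∀ i, -(N : ℤ) ≤ x i ∧ x i ≤ N := by
  simp [boxV, Fintype.mem_piFinset]

theorem latAdj_comm {x y : V4} : latAdj x y ↔ latAdj y x := by
  simp only [latAdj, abs_sub_comm]

theorem mk_mem_boxEdges {N : ℕ} {x y : V4} :
    s(x, y) ∈ boxEdges N ↔ x ∈ boxV N ∧ y ∈ boxV N ∧ latAdj x y := by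
  simp only [boxEdges, Finset.mem_image, Finset.mem_filter, Finset.mem_product, Prod.exists]
  constructor
  · rintro ⟨a, b, ⟨⟨ha, hb⟩, hab⟩, h⟩
    rcases Sym2.eq_iff.1 h with ⟨rfl, rfl⟩ | ⟨rfl, rfl⟩
    · exact ⟨ha, hb, hab⟩
    · exact ⟨hb, ha, latAdj_comm.1 hab⟩
  · rintro ⟨hx, hy, h⟩
    exact ⟨x, y, ⟨⟨hx, hy⟩, h⟩, rfl⟩

theorem latAdj_iff {u w : V4} :
    latAdj u w ↔ ∃ i, w = u + Pi.single i 1 ∨ w = (u : V4) - Pi.single i 1 := by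
  constructor
  · intro h
    have h1 : ∃ i, u i - w i ≠ 0 := by
      by_contra! h0
      simp [latAdj, h0] at h
    obtain ⟨i, hi⟩ := h1
    have hi1 : 1 ≤ |u i - w i| := Int.one_le_abs hi
    unfold latAdj at h
    rw [← Finset.add_sum_erase _ _ (Finset.mem_univ i)] at h
    have h2 : ∑ j ∈ Finset.univ.erase i, |u j - w j| = 0 :=
      le_antisymm (by linarith) (Finset.sum_nonneg fun _ _ => abs_nonneg _)
    have h3 : |u i - w i| = 1 := by linarith
    rw [Finset.sum_eq_zero_iff_of_nonneg (fun _ _ => abs_nonneg _)] at h2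
    have h4 : ∀ j, j ≠ i → u j = w j := fun j hj => by
      have := h2 j (by simp [hj])
      rw [abs_eq_zero] at this; linarith
    refine ⟨i, ?_⟩
    rcases (abs_eq one_pos.le).1 h3 with h5 | h5
    · right
      ext j
      by_cases hj : j = i
      · subst hj; simp; linarith
      · simp [hj, h4 j hj]
    · left
      ext j
      by_cases hj : j = i
      · subst hj; simp; linarith
      · simp [hj, h4 j hj]
  · rintro ⟨i, rfl | rfl⟩
    · simp only [latAdj, Pi.add_apply, sub_add_cancel_left, abs_neg]
      rw [Finset.sum_eq_single i (fun j _ hj => by simp [hj]) (by simp)]; simp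
    · simp only [latAdj, Pi.sub_apply, sub_sub_cancel]
      rw [Finset.sum_eq_single i (fun j _ hj => by simp [hj]) (by simp)]; simp

theorem ite_latAdj (u w : V4) : (if latAdj u w then (1 : ℝ) else 0)
    = ∑ i, ((if w = u + Pi.single i 1 then (1 : ℝ) else 0)
      + (if w = u - Pi.single i 1 then (1 : ℝ) else 0)) := by
  by_cases h : latAdj u w
  · rw [if_pos h]
    obtain ⟨i, hi⟩ := latAdj_iff.1 h
    rw [Finset.sum_eq_single i _ (by simp)]
    · have hne : u + Pi.single i 1 ≠ u - Pi.single i 1 := fun e => by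
        have := congrFun e i
        simp at this; omega
      rcases hi with rfl | rfl
      · simp [hne]
      · simp [hne.symm]
    · intro j _ hj
      have h1 : w ≠ u + Pi.single j 1 := by
        rintro rfl
        have := fun k => hi.imp (fun e => congrFun e k) (fun e => congrFun e k)
        have := this j
        simp [hj] at this
      have h2 : w ≠ u - Pi.single j 1 := by
        rintro rfl
        have := fun k => hi.imp (fun e => congrFun e k) (fun e => congrFun e k)
        have := this j
        simp [hj] at this
      simp [h1, h2]
  · rw [if_neg h]
    symm
    refine Finset.sum_eq_zero fun i _ => ?_
    rw [if_neg (fun e => h (latAdj_iff.2 ⟨i, Or.inl e⟩)),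
      if_neg (fun e => h (latAdj_iff.2 ⟨i, Or.inr e⟩)), add_zero]

theorem sum_edgeCond_boxEdges_mul {N : ℕ} (u : boxV N) (ψ : V4 → ℝ) :
    ∑ w : boxV N, edgeCond (boxV N) (boxEdges N) u w * ψ w
      = ∑ i, ((if (u : V4) + Pi.single i 1 ∈ boxV N then ψ ((u : V4) + Pi.single i 1) else 0)
        + (if (u : V4) - Pi.single i 1 ∈ boxV N then ψ ((u : V4) - Pi.single i 1) else 0)) := by
  have h1 : ∀ w : boxV N, edgeCond (boxV N) (boxEdges N) u w * ψ w
      = ∑ i, ((if (w : V4) = (u : V4) + Pi.single i 1 then ψ w else 0)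
        + (if (w : V4) = (u : V4) - Pi.single i 1 then ψ w else 0)) := by
    intro w
    have : edgeCond (boxV N) (boxEdges N) u w = if latAdj u w then (1 : ℝ) else 0 := by
      simp [edgeCond, mk_mem_boxEdges]
    rw [this, ite_latAdj, Finset.sum_mul]
    exact Finset.sum_congr rfl fun i _ => by simp only [add_mul, ite_mul, one_mul, zero_mul]
  rw [Finset.sum_congr rfl fun w _ => h1 w, Finset.sum_comm]
  refine Finset.sum_congr rfl fun i _ => ?_
  rw [Finset.sum_add_distrib]
  have h2 : ∀ v : V4, ∑ w : boxV N, (if (w : V4) = v then ψ w else 0)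
      = if v ∈ boxV N then ψ v else 0 := by
    intro v
    rw [Finset.sum_coe_sort (boxV N) (fun w => if w = v then ψ w else 0), Finset.sum_ite_eq']
  rw [h2, h2]

theorem sum_edgeCond_boxEdges_le {N : ℕ} (u : boxV N) :
    ∑ w, edgeCond (boxV N) (boxEdges N) u w ≤ 8 := by
  have := sum_edgeCond_boxEdges_mul u (fun _ => 1)
  simp only [mul_one] at this
  rw [this]
  calc _ ≤ ∑ i : Fin 4, ((1 : ℝ) + 1) := by
        gcongr <;> split_ifs <;> norm_num
    _ = 8 := by norm_num

/-! ### Unfolding a box onto a torus -/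

/-- The map folding a cycle of length `4 * N + 2` onto the interval `[-N, N]`. -/
def foldOne (N : ℕ) (z : ZMod (4 * N + 2)) : ℤ :=
  if z.val ≤ 2 * N then (z.val : ℤ) - N else 3 * N + 1 - z.val

theorem foldOne_mem (N : ℕ) (z : ZMod (4 * N + 2)) : -(N : ℤ) ≤ foldOne N z ∧ foldOne N z ≤ N := by
  have := ZMod.val_lt z
  unfold foldOne; split_ifs <;> omega

theorem val_add_one_cases {m : ℕ} (hm : 1 < m) (z : ZMod m) :
    (z + 1).val = z.val + 1 ∧ z.val + 1 < m ∨ (z + 1).val = 0 ∧ z.val + 1 = m := by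
  have : NeZero m := ⟨by omega⟩
  have : Fact (1 < m) := ⟨hm⟩
  have h1 := ZMod.val_lt z
  rw [ZMod.val_add, ZMod.val_one]
  rcases Nat.lt_or_ge (z.val + 1) m with h | h
  · exact Or.inl ⟨Nat.mod_eq_of_lt h, h⟩
  · have : z.val + 1 = m := by omega
    exact Or.inr ⟨by rw [this, Nat.mod_self], this⟩

theorem foldOne_neighbours (N : ℕ) (z : ZMod (4 * N + 2)) :
    (foldOne N (z + 1) = (if foldOne N z + 1 ≤ N then foldOne N z + 1 else foldOne N z) ∧
      foldOne N (z - 1) = (if -(N : ℤ) ≤ foldOne N z - 1 then foldOne N z - 1 else foldOne N z)) ∨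
    (foldOne N (z - 1) = (if foldOne N z + 1 ≤ N then foldOne N z + 1 else foldOne N z) ∧
      foldOne N (z + 1) =
        (if -(N : ℤ) ≤ foldOne N z - 1 then foldOne N z - 1 else foldOne N z)) := by
  have h1 := val_add_one_cases (by omega : 1 < 4 * N + 2) z
  have h2 := val_add_one_cases (by omega : 1 < 4 * N + 2) (z - 1)
  rw [sub_add_cancel] at h2
  have h3 := ZMod.val_lt z
  have h4 := ZMod.val_lt (z - 1)
  unfold foldOne
  generalize (z + 1).val = p at *
  generalize (z - 1).val = q at *
  generalize z.val = t at *
  by_cases ht : t ≤ 2 * N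
  · left
    constructor <;> split_ifs <;> omega
  · right
    constructor <;> split_ifs <;> omega

theorem card_foldOne_fiber (N : ℕ) (a : ℤ) :
    (Finset.univ.filter fun z => foldOne N z = a).card ≤ 2 := by
  have : (Finset.univ.filter fun z => foldOne N z = a)
      ⊆ {((a + N : ℤ) : ZMod (4 * N + 2)), ((3 * N + 1 - a : ℤ) : ZMod (4 * N + 2))} := by
    intro z hz
    simp only [Finset.mem_filter, Finset.mem_univ, true_and] at hz
    have hz' : z = ((z.val : ℤ) : ZMod (4 * N + 2)) := by simp
    simp only [Finset.mem_insert, Finset.mem_singleton]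
    unfold foldOne at hz
    split_ifs at hz with h
    · left; rw [hz', ← hz]; congr 1; omega
    · right; rw [hz', ← hz]; congr 1; omega
  exact (Finset.card_le_card this).trans Finset.card_le_two

/-- The map folding a torus of side length `4 * N + 2` onto the box `[-N, N]⁴`. -/
def foldBox (N : ℕ) (z : Fin 4 → ZMod (4 * N + 2)) : boxV N :=
  ⟨fun i => foldOne N (z i), mem_boxV.2 fun i => foldOne_mem N (z i)⟩

theorem foldBox_surjective (N : ℕ) : Function.Surjective (foldBox N) := by
  intro u
  have hu := mem_boxV.1 u.2
  refine ⟨fun i => (((u : V4) i + N : ℤ) : ZMod (4 * N + 2)), ?_⟩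
  ext i
  have hi := hu i
  have hval : ((((u : V4) i + N : ℤ) : ZMod (4 * N + 2)).val : ℤ) = (u : V4) i + N := by
    rw [ZMod.val_intCast]
    exact Int.emod_eq_of_lt (by omega) (by push_cast; omega)
  simp only [foldBox, foldOne]
  generalize ((((u : V4) i + N : ℤ) : ZMod (4 * N + 2)).val) = t at *
  split_ifs <;> omega

theorem card_foldBox_fiber (N : ℕ) (u : boxV N) :
    (Finset.univ.filter fun z => foldBox N z = u).card ≤ 16 := by
  have : (Finset.univ.filter fun z => foldBox N z = u)
      ⊆ Fintype.piFinset fun i => Finset.univ.filter fun z => foldOne N z = (u : V4) i := by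
    intro z hz
    simp only [Finset.mem_filter, Finset.mem_univ, true_and] at hz
    simp [Fintype.mem_piFinset, ← hz, foldBox]
  refine (Finset.card_le_card this).trans ?_
  rw [Fintype.card_piFinset]
  calc _ ≤ ∏ _i : Fin 4, 2 := Finset.prod_le_prod' fun i _ => card_foldOne_fiber N _
    _ = 16 := by norm_num

theorem torLap_comp_foldBox {N : ℕ} (h : boxV N → ℝ) (z : Fin 4 → ZMod (4 * N + 2)) :
    torLap (h ∘ foldBox N) z = netLap (edgeCond (boxV N) (boxEdges N)) h (foldBox N z) := by
  set H : V4 → ℝ := fun x => if hx : x ∈ boxV N then h ⟨x, hx⟩ else 0 with hH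
  have hHh : ∀ u : boxV N, H u = h u := fun u => by simp [hH]
  set u := foldBox N z with hu
  have h1 : netLap (edgeCond (boxV N) (boxEdges N)) h u = ∑ w : boxV N,
      edgeCond (boxV N) (boxEdges N) u w * (fun x => h u - H x) w := by
    simp only [netLap, hHh]
  rw [h1, sum_edgeCond_boxEdges_mul u (fun x => h u - H x), torLap]
  refine Finset.sum_congr rfl fun i _ => ?_
  have hF : ∀ s : ZMod (4 * N + 2), (foldBox N (z + Pi.single i s) : V4)
      = Function.update (u : V4) i (foldOne N (z i + s)) := by
    intro s
    ext j
    by_cases hj : j = i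
    · subst hj; simp [foldBox]
    · simp [foldBox, hj, hu]
  have hHF : ∀ s : ZMod (4 * N + 2), h (foldBox N (z + Pi.single i s))
      = H (Function.update (u : V4) i (foldOne N (z i + s))) := fun s => by rw [← hF, hHh]
  have hui : (u : V4) i = foldOne N (z i) := rfl
  have hp : ∀ s : ZMod (4 * N + 2), foldOne N (z i + s)
        = (if foldOne N (z i) + 1 ≤ N then foldOne N (z i) + 1 else foldOne N (z i)) →
      h u - h (foldBox N (z + Pi.single i s))
        = if (u : V4) + Pi.single i 1 ∈ boxV N then h u - H ((u : V4) + Pi.single i 1) else 0 := by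
    intro s hs
    rw [hHF, hs]
    by_cases hc : foldOne N (z i) + 1 ≤ N
    · have h2 : Function.update (u : V4) i (foldOne N (z i) + 1) = (u : V4) + Pi.single i 1 := by
        ext j
        by_cases hj : j = i
        · subst hj; simp [hui]
        · simp [hj]
      rw [if_pos hc, h2, if_pos]
      rw [← h2, mem_boxV]
      intro j
      by_cases hj : j = i
      · subst hj
        have := foldOne_mem N (z j)
        simp; omega
      · simp [hj]; exact mem_boxV.1 u.2 j
    · rw [if_neg hc, if_neg, ← hui, Function.update_eq_self, hHh, sub_self]
      intro hm
      have := (mem_boxV.1 hm i).2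
      simp [hui] at this
      omega
  have hn : ∀ s : ZMod (4 * N + 2), foldOne N (z i + s)
        = (if -(N : ℤ) ≤ foldOne N (z i) - 1 then foldOne N (z i) - 1 else foldOne N (z i)) →
      h u - h (foldBox N (z + Pi.single i s))
        = if (u : V4) - Pi.single i 1 ∈ boxV N then h u - H ((u : V4) - Pi.single i 1) else 0 := by
    intro s hs
    rw [hHF, hs]
    by_cases hc : -(N : ℤ) ≤ foldOne N (z i) - 1
    · have h2 : Function.update (u : V4) i (foldOne N (z i) - 1) = (u : V4) - Pi.single i 1 := by
        ext j
        by_cases hj : j = i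
        · subst hj; simp [hui]
        · simp [hj]
      rw [if_pos hc, h2, if_pos]
      rw [← h2, mem_boxV]
      intro j
      by_cases hj : j = i
      · subst hj
        have := foldOne_mem N (z j)
        simp; omega
      · simp [hj]; exact mem_boxV.1 u.2 j
    · rw [if_neg hc, if_neg, ← hui, Function.update_eq_self, hHh, sub_self]
      intro hm
      have := (mem_boxV.1 hm i).1
      simp [hui] at this
      omega
  have hneg : z - Pi.single i 1 = z + Pi.single i (-1) := by
    rw [Pi.single_neg, sub_eq_add_neg]
  simp only [Function.comp_apply, hneg, ← hu]
  rcases foldOne_neighbours N (z i) with ⟨ha, hb⟩ | ⟨ha, hb⟩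
  · rw [hp 1 ha, hn (-1) (by rw [← sub_eq_add_neg]; exact hb)]
  · rw [hn 1 hb, hp (-1) (by rw [← sub_eq_add_neg]; exact ha), add_comm]

/-- The constant in the Poincaré-type inequality for a box. -/
def boxConst (N : ℕ) : ℝ := 512 * (1 + Real.log (4 * N + 2))

theorem boxConst_nonneg (N : ℕ) : 0 ≤ boxConst N := by
  have : 0 ≤ Real.log (4 * N + 2) := Real.log_nonneg (by
    have : (0 : ℝ) ≤ N := Nat.cast_nonneg N
    linarith)
  unfold boxConst; positivity

theorem exists_sum_sub_sq_le_netLap {N : ℕ} (h : boxV N → ℝ) :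
    ∃ a : ℝ, ∑ u, (h u - a) ^ 2
      ≤ boxConst N * (∑ u, |netLap (edgeCond (boxV N) (boxEdges N)) h u|) ^ 2 := by
  obtain ⟨a, ha⟩ := exists_sum_sub_sq_le_torLap (h ∘ foldBox N)
  refine ⟨a, ?_⟩
  have hfib : ∀ f : boxV N → ℝ, ∑ z, f (foldBox N z)
      = ∑ u, ((Finset.univ.filter fun z => foldBox N z = u).card : ℝ) * f u := by
    intro f
    rw [← Finset.sum_fiberwise Finset.univ (foldBox N)]
    refine Finset.sum_congr rfl fun u _ => ?_
    rw [Finset.sum_congr rfl (g := fun _ => f u), Finset.sum_const, nsmul_eq_mul]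
    intro z hz
    rw [(Finset.mem_filter.1 hz).2]
  have h1 : ∑ u, (h u - a) ^ 2 ≤ ∑ z, ((h ∘ foldBox N) z - a) ^ 2 := by
    rw [show ∑ z, ((h ∘ foldBox N) z - a) ^ 2 = ∑ z, (fun u => (h u - a) ^ 2) (foldBox N z) from rfl,
      hfib (fun u => (h u - a) ^ 2)]
    refine Finset.sum_le_sum fun u _ => ?_
    have : (1 : ℝ) ≤ ((Finset.univ.filter fun z => foldBox N z = u).card : ℝ) := by
      obtain ⟨z, hz⟩ := foldBox_surjective N u
      have : 0 < (Finset.univ.filter fun z => foldBox N z = u).card :=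
        Finset.card_pos.2 ⟨z, by simp [hz]⟩
      exact_mod_cast this
    nlinarith [sq_nonneg (h u - a)]
  have h2 : ∑ z, |torLap (h ∘ foldBox N) z|
      ≤ 16 * ∑ u, |netLap (edgeCond (boxV N) (boxEdges N)) h u| := by
    simp only [torLap_comp_foldBox]
    rw [hfib (fun u => |netLap (edgeCond (boxV N) (boxEdges N)) h u|), Finset.mul_sum]
    refine Finset.sum_le_sum fun u _ => ?_
    have : ((Finset.univ.filter fun z => foldBox N z = u).card : ℝ) ≤ 16 := by
      exact_mod_cast card_foldBox_fiber N u
    gcongr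
  have h3 : 0 ≤ ∑ z, |torLap (h ∘ foldBox N) z| := Finset.sum_nonneg fun _ _ => abs_nonneg _
  have h4 : (∑ z, |torLap (h ∘ foldBox N) z|) ^ 2
      ≤ (16 * ∑ u, |netLap (edgeCond (boxV N) (boxEdges N)) h u|) ^ 2 := by gcongr
  have h5 := boxConst_nonneg N
  have h6 : 2 * (1 + Real.log ((4 * N + 2 : ℕ) : ℝ)) = boxConst N / 256 := by
    unfold boxConst; push_cast; ring
  rw [h6] at ha
  calc _ ≤ boxConst N / 256 * (∑ z, |torLap (h ∘ foldBox N) z|) ^ 2 := h1.trans ha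
    _ ≤ boxConst N / 256 * (16 * ∑ u, |netLap (edgeCond (boxV N) (boxEdges N)) h u|) ^ 2 := by
        gcongr
    _ = _ := by ring

theorem netNondeg_box {N : ℕ} {A : Finset (boxV N)} (hA : A.Nonempty) :
    NetNondeg (edgeCond (boxV N) (boxEdges N)) A := by
  intro h h0 he
  obtain ⟨a, ha⟩ := exists_sum_sub_sq_le_netLap h
  have h1 : ∀ u, netLap (edgeCond (boxV N) (boxEdges N)) h u = 0 :=
    netLap_eq_zero_of_netEnergy_eq_zero edgeCond_nonneg he
  simp only [h1, abs_zero, Finset.sum_const_zero] at ha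
  have h2 : ∑ u, (h u - a) ^ 2 = 0 :=
    le_antisymm (by simpa using ha) (Finset.sum_nonneg fun _ _ => sq_nonneg _)
  rw [Finset.sum_eq_zero_iff_of_nonneg (fun _ _ => sq_nonneg _)] at h2
  have h3 : ∀ u, h u = a := fun u => by
    have := h2 u (Finset.mem_univ u)
    rw [sq_eq_zero_iff] at this; linarith
  obtain ⟨v, hv⟩ := hA
  have h4 : a = 0 := by rw [← h3 v, h0 v hv]
  ext u
  rw [h3 u, h4]; rfl

/-! ### Comparison with a killed network -/

/-- The network obtained by joining every vertex to an additional vertex, with conductance `l`. -/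
def killCond {V : Type*} (c : V → V → ℝ) (l : ℝ) : Option V → Option V → ℝ
  | none, none => 0
  | none, some _ => l
  | some _, none => l
  | some u, some w => c u w

section Killed

variable {V : Type*} {c : V → V → ℝ} {l : ℝ}

theorem killCond_comm (hc : ∀ u w, c u w = c w u) (u w : Option V) :
    killCond c l u w = killCond c l w u := by
  cases u <;> cases w <;> simp [killCond]
  exact hc _ _

theorem killCond_nonneg (h0 : ∀ u w, 0 ≤ c u w) (hl : 0 ≤ l) (u w : Option V) :
    0 ≤ killCond c l u w := by
  cases u <;> cases w <;> simp [killCond, hl, h0]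

variable [Fintype V]

theorem netEnergy_killCond (g : Option V → ℝ) :
    netEnergy (killCond c l) g
      = netEnergy c (fun u => g (some u)) + l * ∑ u, (g (some u) - g none) ^ 2 := by
  simp only [netEnergy, Fintype.sum_option, killCond, Finset.sum_add_distrib, ← Finset.mul_sum]
  have : ∑ u, (g none - g (some u)) ^ 2 = ∑ u, (g (some u) - g none) ^ 2 :=
    Finset.sum_congr rfl fun u _ => by ring
  rw [this]
  ring

theorem netNondeg_killCond (h0 : ∀ u w, 0 ≤ c u w) (hl : 0 < l) {A : Finset (Option V)}
    (hA : A.Nonempty) : NetNondeg (killCond c l) A := by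
  intro g hg he
  rw [netEnergy_killCond] at he
  have h1 := netEnergy_nonneg h0 (fun u => g (some u))
  have h2 : 0 ≤ ∑ u, (g (some u) - g none) ^ 2 := Finset.sum_nonneg fun _ _ => sq_nonneg _
  have h3 : ∑ u, (g (some u) - g none) ^ 2 = 0 := by nlinarith
  rw [Finset.sum_eq_zero_iff_of_nonneg (fun _ _ => sq_nonneg _)] at h3
  have h4 : ∀ u, g (some u) = g none := fun u => by
    have := h3 u (Finset.mem_univ u)
    rw [sq_eq_zero_iff] at this; linarith
  have h5 : ∀ u, g u = g none := fun u => by cases u <;> simp [h4]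
  obtain ⟨a, ha⟩ := hA
  have h6 : g none = 0 := by rw [← h5 a, hg a ha]
  ext u
  rw [h5 u, h6]; rfl

variable [DecidableEq V]

theorem netEnergy_single_le (hc : ∀ u w, c u w = c w u) (h0 : ∀ u w, 0 ≤ c u w) (v : V) :
    netEnergy c (Pi.single v 1) ≤ ∑ w, c v w := by
  rw [← sum_mul_netLap_self hc, Finset.sum_eq_single v (fun u _ hu => by simp [hu]) (by simp)]
  simp only [Pi.single_eq_same, one_mul, netLap]
  refine Finset.sum_le_sum fun w _ => ?_
  have : (0 : ℝ) ≤ (Pi.single v 1 : V → ℝ) w := by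
    rw [Pi.single_apply]; split_ifs <;> norm_num
  nlinarith [h0 v w]

theorem one_le_netGreen_mul (hc : ∀ u w, c u w = c w u) (h0 : ∀ u w, 0 ≤ c u w) {A : Finset V}
    (h : NetNondeg c A) {v : V} (hv : v ∉ A) {d : ℝ} (hd : ∑ w, c v w ≤ d) :
    1 ≤ netGreen c A v v * d := by
  have h1 := sq_le_netGreen_mul_netEnergy hc h0 h hv (g := Pi.single v 1)
    (fun u hu => by rw [Pi.single_apply, if_neg]; rintro rfl; exact hv hu)
  rw [Pi.single_eq_same, one_pow] at h1
  exact h1.trans (mul_le_mul_of_nonneg_left ((netEnergy_single_le hc h0 v).trans hd)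
    (netGreen_self_pos hc h0 h hv).le)

theorem sum_abs_netLap_netGreen (hc : ∀ u w, c u w = c w u) (h0 : ∀ u w, 0 ≤ c u w) {A : Finset V}
    (h : NetNondeg c A) {v : V} (hv : v ∉ A) :
    ∑ u, |netLap c (netGreen c A v) u| = 2 := by
  have hd := h.det_ne_zero hc
  have h1 : ∀ u, |netLap c (netGreen c A v) u|
      = 2 * (if u = v then 1 else 0) - netLap c (netGreen c A v) u := by
    intro u
    by_cases hu : u ∈ A
    · have h2 : netLap c (netGreen c A v) u ≤ 0 := by
        rw [netLap, netGreen_of_mem hd hv hu]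
        refine Finset.sum_nonpos fun w _ => ?_
        have := mul_nonneg (h0 u w) (netGreen_nonneg hc h0 h hv w)
        linarith
      have h3 : u ≠ v := fun e => hv (e ▸ hu)
      rw [abs_of_nonpos h2, if_neg h3]; ring
    · rw [netLap_netGreen hd hu]
      split_ifs <;> norm_num
  have h4 : ∑ u, netLap c (netGreen c A v) u = 0 := by
    have := sum_mul_netLap hc (fun _ => 1) (netGreen c A v)
    simpa using this
  rw [Finset.sum_congr rfl fun u _ => h1 u, Finset.sum_sub_distrib, h4]
  simp

theorem netGreen_le_killCond (hc : ∀ u w, c u w = c w u) (h0 : ∀ u w, 0 ≤ c u w) {A : Finset V}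
    (h : NetNondeg c A) (hA : A.Nonempty) {v : V} (hv : v ∉ A) (hl : 0 < l) {C : ℝ} (hC : 0 ≤ C)
    (hd : ∑ w, c v w ≤ 8)
    (H : ∀ g : V → ℝ, ∃ a : ℝ, ∑ u, (g u - a) ^ 2 ≤ C * (∑ u, |netLap c g u|) ^ 2) :
    netGreen c A v v
      ≤ (1 + 32 * l * C) * netGreen (killCond c l) (A.map .some) (some v) (some v) := by
  have hR := netGreen_self_pos hc h0 h hv
  have hR8 := one_le_netGreen_mul hc h0 h hv hd
  have hdet := h.det_ne_zero hc
  have hv' : some v ∉ A.map .some := by simpa using hv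
  have hK := netNondeg_killCond (c := c) h0 hl (hA.map (f := .some))
  have hRH := netGreen_self_pos (killCond_comm hc) (killCond_nonneg h0 hl.le) hK hv'
  obtain ⟨a, ha⟩ := H (netGreen c A v)
  rw [sum_abs_netLap_netGreen hc h0 h hv] at ha
  have h1 := sq_le_netGreen_mul_netEnergy (killCond_comm hc) (killCond_nonneg h0 hl.le) hK hv'
    (g := fun o => o.elim a (netGreen c A v)) (by
      intro u hu
      obtain ⟨w, hw, rfl⟩ := Finset.mem_map.1 hu
      exact netGreen_of_mem hdet hv hw)
  rw [netEnergy_killCond] at h1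
  simp only [Option.elim_some, Option.elim_none] at h1
  rw [netEnergy_netGreen hc hdet hv] at h1
  set R := netGreen c A v v
  set RH := netGreen (killCond c l) (A.map .some) (some v) (some v)
  have h2 : l * ∑ u, (netGreen c A v u - a) ^ 2 ≤ l * (C * 2 ^ 2) := by gcongr
  have h3 : l * (C * 2 ^ 2) ≤ 32 * l * C * R := by
    have : 0 ≤ l * C := by positivity
    nlinarith
  have h4 : R ^ 2 ≤ RH * (R + 32 * l * C * R) :=
    h1.trans (mul_le_mul_of_nonneg_left (by linarith) hRH.le)
  have h5 : R * R ≤ R * ((1 + 32 * l * C) * RH) := by nlinarith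
  exact le_of_mul_le_mul_left h5 hR

theorem one_le_netGreen_none_mul (hc : ∀ u w, c u w = c w u) (h0 : ∀ u w, 0 ≤ c u w)
    {A : Finset V} (hA : A.Nonempty) (hl : 0 < l) :
    1 ≤ netGreen (killCond c l) (A.map .some) none none * (l * Fintype.card V) := by
  refine one_le_netGreen_mul (killCond_comm hc) (killCond_nonneg h0 hl.le)
    (netNondeg_killCond h0 hl hA.map) (by simp) ?_
  simp [Fintype.sum_option, killCond, mul_comm]

theorem netGreen_none_mul_le (hc : ∀ u w, c u w = c w u) (h0 : ∀ u w, 0 ≤ c u w)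
    {A : Finset V} (hA : A.Nonempty) (hl : 0 < l) :
    netGreen (killCond c l) (A.map .some) none none * l ≤ 1 := by
  have hn : (none : Option V) ∉ A.map .some := by simp
  have hK := netNondeg_killCond (c := c) h0 hl (hA.map (f := .some))
  have hR := netGreen_self_pos (killCond_comm hc) (killCond_nonneg h0 hl.le) hK hn
  have hd := hK.det_ne_zero (killCond_comm hc)
  have h1 := netEnergy_netGreen (killCond_comm hc) hd hn
  obtain ⟨x, hx⟩ := hA
  rw [netEnergy_killCond] at h1
  have h2 := netEnergy_nonneg h0 (fun u => netGreen (killCond c l) (A.map .some) none (some u))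
  have h3 := Finset.single_le_sum (f := fun u =>
    (netGreen (killCond c l) (A.map .some) none (some u)
      - netGreen (killCond c l) (A.map .some) none none) ^ 2)
    (fun u _ => sq_nonneg _) (Finset.mem_univ x)
  rw [netGreen_of_mem hd hn (u := some x) (by simpa using hx)] at h3
  set R := netGreen (killCond c l) (A.map .some) none none
  have h4 : l * (0 - R) ^ 2 ≤ R := by
    have := mul_le_mul_of_nonneg_left h3 hl.le
    linarith
  have h5 : R * (R * l) ≤ R * 1 := by nlinarith
  exact le_of_mul_le_mul_left h5 hR

theorem det_dirMat_insertNone (hc : ∀ u w, c u w = c w u) (h0 : ∀ u w, 0 ≤ c u w)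
    {A : Finset V} (hA : A.Nonempty) (hl : 0 < l) :
    (dirMat (killCond c l) (Finset.insertNone A)).det
      = netGreen (killCond c l) (A.map .some) none none
        * (dirMat (killCond c l) (A.map .some)).det := by
  rw [← det_dirMat_insert ((netNondeg_killCond h0 hl hA.map).det_ne_zero (killCond_comm hc))]
  congr 2
  ext o
  cases o <;> simp

theorem det_dirMat_map_some_le (hc : ∀ u w, c u w = c w u) (h0 : ∀ u w, 0 ≤ c u w)
    {A : Finset V} (hA : A.Nonempty) (hl : 0 < l) :
    (dirMat (killCond c l) (A.map .some)).det
      ≤ l * Fintype.card V * (dirMat (killCond c l) (Finset.insertNone A)).det := by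
  have h1 := det_dirMat_pos (killCond_comm hc) (killCond_nonneg h0 hl.le)
    (netNondeg_killCond (c := c) h0 hl (hA.map (f := .some)))
  rw [det_dirMat_insertNone hc h0 hA hl]
  have h2 := one_le_netGreen_none_mul hc h0 hA hl
  nlinarith

theorem mul_det_dirMat_insertNone_le (hc : ∀ u w, c u w = c w u) (h0 : ∀ u w, 0 ≤ c u w)
    {A : Finset V} (hA : A.Nonempty) (hl : 0 < l) :
    l * (dirMat (killCond c l) (Finset.insertNone A)).det
      ≤ (dirMat (killCond c l) (A.map .some)).det := by
  have h1 := det_dirMat_pos (killCond_comm hc) (killCond_nonneg h0 hl.le)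
    (netNondeg_killCond (c := c) h0 hl (hA.map (f := .some)))
  rw [det_dirMat_insertNone hc h0 hA hl]
  have h2 := netGreen_none_mul_le hc h0 hA hl
  nlinarith

end Killed

/-! ### Nested boxes -/

/-- The unit conductances on the edges of a box. -/
def boxCond (N : ℕ) : boxV N → boxV N → ℝ := edgeCond (boxV N) (boxEdges N)

theorem boxCond_comm {N : ℕ} (u w : boxV N) : boxCond N u w = boxCond N w u := edgeCond_comm u w

theorem boxCond_nonneg {N : ℕ} (u w : boxV N) : 0 ≤ boxCond N u w := edgeCond_nonneg u w

theorem boxV_mono {N M : ℕ} (h : N ≤ M) : boxV N ⊆ boxV M := by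
  intro x hx
  rw [mem_boxV] at *
  intro i
  have := hx i
  omega

/-- The inclusion of a box into a larger box. -/
def boxIncl {N M : ℕ} (h : N ≤ M) : boxV N ↪ boxV M :=
  Subtype.impEmbedding _ _ fun _ hx => boxV_mono h hx

theorem coe_boxIncl {N M : ℕ} (h : N ≤ M) (u : boxV N) : (boxIncl h u : V4) = u := rfl

theorem netEnergy_boxIncl_le {N M : ℕ} (h : N ≤ M) (g : boxV M → ℝ) :
    netEnergy (boxCond N) (fun u => g (boxIncl h u)) ≤ netEnergy (boxCond M) g := by
  have key : ∀ f : boxV M → ℝ, (∀ u, 0 ≤ f u) → ∑ u, f (boxIncl h u) ≤ ∑ u, f u := by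
    intro f hf
    rw [← Finset.sum_map Finset.univ (boxIncl h) f]
    exact Finset.sum_le_univ_sum_of_nonneg hf
  unfold netEnergy
  have hnn : ∀ u w, 0 ≤ boxCond M u w * (g u - g w) ^ 2 := fun u w =>
    mul_nonneg (boxCond_nonneg u w) (sq_nonneg _)
  gcongr ?_ / 2
  calc _ ≤ ∑ u, ∑ w, boxCond M (boxIncl h u) (boxIncl h w)
          * (g (boxIncl h u) - g (boxIncl h w)) ^ 2 := by
        refine Finset.sum_le_sum fun u _ => Finset.sum_le_sum fun w _ => ?_
        refine mul_le_mul_of_nonneg_right ?_ (sq_nonneg _)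
        simp only [boxCond, edgeCond, mk_mem_boxEdges, coe_boxIncl]
        split_ifs with h1 h2
        · exact le_rfl
        · exact absurd ⟨boxV_mono h h1.1, boxV_mono h h1.2.1, h1.2.2⟩ h2
        · norm_num
        · exact le_rfl
    _ ≤ ∑ u, ∑ w, boxCond M (boxIncl h u) w * (g (boxIncl h u) - g w) ^ 2 :=
        Finset.sum_le_sum fun u _ => key _ fun w => hnn _ w
    _ ≤ _ := key (fun u => ∑ w, boxCond M u w * (g u - g w) ^ 2)
        fun u => Finset.sum_nonneg fun w _ => hnn u w

/-- The relative error made in the comparison of a box with the associated killed network. -/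
def killErr (N : ℕ) (l : ℝ) : ℝ := 32 * l * boxConst N

theorem det_dirMat_box_insert_le {N M : ℕ} (h : N ≤ M) {A : Finset (boxV N)} (hA : A.Nonempty)
    {v : boxV N} (hv : v ∉ A) {l : ℝ} (hl : 0 < l) :
    (dirMat (boxCond M) ((insert v A).map (boxIncl h))).det
      ≤ (1 + killErr N l) * netGreen (killCond (boxCond N) l) (A.map .some) (some v) (some v)
        * (dirMat (boxCond M) (A.map (boxIncl h))).det := by
  have hN : NetNondeg (boxCond N) A := netNondeg_box hA
  have hM : NetNondeg (boxCond M) (A.map (boxIncl h)) := netNondeg_box hA.map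
  have h1 : netGreen (boxCond N) A v v ≤ (1 + killErr N l)
      * netGreen (killCond (boxCond N) l) (A.map .some) (some v) (some v) :=
    netGreen_le_killCond boxCond_comm boxCond_nonneg hN hA hv hl (boxConst_nonneg N)
      (sum_edgeCond_boxEdges_le v) exists_sum_sub_sq_le_netLap
  have h2 := netGreen_self_pos boxCond_comm boxCond_nonneg hN hv
  rw [Finset.map_insert]
  refine det_dirMat_insert_le boxCond_comm
    (det_dirMat_pos boxCond_comm boxCond_nonneg hM).le (by simpa using hv) (h2.le.trans h1) ?_
  intro g hg
  have h3 := sq_le_netGreen_mul_netEnergy boxCond_comm boxCond_nonneg hN hv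
    (g := fun u => g (boxIncl h u)) (fun u hu => hg _ (Finset.mem_map_of_mem _ hu))
  calc _ ≤ _ := h3
    _ ≤ netGreen (boxCond N) A v v * netEnergy (boxCond M) g :=
        mul_le_mul_of_nonneg_left (netEnergy_boxIncl_le h g) h2.le
    _ ≤ _ := mul_le_mul_of_nonneg_right h1 (netEnergy_nonneg boxCond_nonneg g)

theorem killErr_nonneg {N : ℕ} {l : ℝ} (hl : 0 < l) : 0 ≤ killErr N l := by
  have := boxConst_nonneg N
  unfold killErr; positivity

theorem det_dirMat_box_mul_le {N M : ℕ} (h : N ≤ M) {x : boxV N} (B : Finset (boxV N))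
    (hx : x ∉ B) {l : ℝ} (hl : 0 < l) :
    (dirMat (boxCond M) ((insert x B).map (boxIncl h))).det
        * (dirMat (killCond (boxCond N) l) (({x} : Finset (boxV N)).map .some)).det
      ≤ (1 + killErr N l) ^ B.card
        * (dirMat (killCond (boxCond N) l) ((insert x B).map .some)).det
        * (dirMat (boxCond M) (({x} : Finset (boxV N)).map (boxIncl h))).det := by
  induction B using Finset.induction_on with
  | empty => simp only [insert_empty_eq, Finset.card_empty, pow_zero, one_mul]; rw [mul_comm]
  | insert v B hv ih =>
    have hxv : x ≠ v := fun e => hx (by simp [e])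
    have hxB : x ∉ B := fun e => hx (by simp [e])
    have hvx : v ∉ insert x B := by simp [hv, hxv.symm]
    have hne : (insert x B).Nonempty := Finset.insert_nonempty x B
    have ih := ih hxB
    have hK := netNondeg_killCond (c := boxCond N) boxCond_nonneg hl (hne.map (f := .some))
    have h1 := det_dirMat_box_insert_le h hne hvx hl
    have h2 := det_dirMat_insert (hK.det_ne_zero (killCond_comm boxCond_comm)) (some v)
    have h3 := netGreen_self_pos (killCond_comm boxCond_comm)
      (killCond_nonneg boxCond_nonneg hl.le) hK (v := some v) (by simpa using hvx)
    have h4 := (det_dirMat_pos (killCond_comm boxCond_comm)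
      (killCond_nonneg boxCond_nonneg hl.le) (netNondeg_killCond (c := boxCond N) boxCond_nonneg hl
        ((Finset.singleton_nonempty x).map (f := .some)))).le
    have h5 := killErr_nonneg (N := N) hl
    rw [Finset.insert_comm, Finset.card_insert_of_notMem hv]
    have h6 : (insert v (insert x B)).map .some = insert (some v) ((insert x B).map .some) := by
      rw [Finset.map_insert]; rfl
    rw [h6, h2]
    set R := netGreen (killCond (boxCond N) l) ((insert x B).map .some) (some v) (some v)
    calc _ ≤ (1 + killErr N l) * R * (dirMat (boxCond M) ((insert x B).map (boxIncl h))).det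
          * (dirMat (killCond (boxCond N) l) (({x} : Finset (boxV N)).map .some)).det :=
          mul_le_mul_of_nonneg_right h1 h4
      _ = (1 + killErr N l) * R * ((dirMat (boxCond M) ((insert x B).map (boxIncl h))).det
          * (dirMat (killCond (boxCond N) l) (({x} : Finset (boxV N)).map .some)).det) := by ring
      _ ≤ (1 + killErr N l) * R * ((1 + killErr N l) ^ B.card
          * (dirMat (killCond (boxCond N) l) ((insert x B).map .some)).det
          * (dirMat (boxCond M) (({x} : Finset (boxV N)).map (boxIncl h))).det) := by
          gcongr
      _ = _ := by ring

theorem div_le_mul_div_of_mul_le {a b p q s t l n E : ℝ} (hl : 0 < l) (ha : 0 ≤ a) (hb : 0 < b)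
    (hq : 0 < q) (hE : 0 ≤ E) (h1 : a * s ≤ E * t * b) (h2 : t ≤ l * n * p) (h3 : l * q ≤ s) :
    a / b ≤ E * n * (p / q) := by
  rw [div_le_iff₀ hb, ← mul_div_assoc, div_mul_eq_mul_div, le_div_iff₀ hq]
  have h8 : l * (a * q) ≤ l * (E * n * p * b) := by
    calc l * (a * q) = a * (l * q) := by ring
      _ ≤ a * s := mul_le_mul_of_nonneg_left h3 ha
      _ ≤ E * t * b := h1
      _ ≤ E * (l * n * p) * b := by gcongr
      _ = _ := by ring
  exact le_of_mul_le_mul_left h8 hl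

theorem det_dirMat_box_div_le {N M : ℕ} (h : N ≤ M) {x : boxV N} (B : Finset (boxV N))
    (hx : x ∉ B) {l : ℝ} (hl : 0 < l) :
    (dirMat (boxCond M) ((insert x B).map (boxIncl h))).det
        / (dirMat (boxCond M) (({x} : Finset (boxV N)).map (boxIncl h))).det
      ≤ (1 + killErr N l) ^ B.card * (boxV N).card
        * ((dirMat (killCond (boxCond N) l) (Finset.insertNone (insert x B))).det
          / (dirMat (killCond (boxCond N) l) (Finset.insertNone {x})).det) := by
  have h1 := det_dirMat_box_mul_le h B hx hl
  have hne : (insert x B).Nonempty := Finset.insert_nonempty x B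
  have h2 := det_dirMat_map_some_le (c := boxCond N) boxCond_comm boxCond_nonneg hne hl
  have h3 := mul_det_dirMat_insertNone_le (c := boxCond N) boxCond_comm boxCond_nonneg
    (Finset.singleton_nonempty x) hl
  have h4 := det_dirMat_pos boxCond_comm boxCond_nonneg
    (netNondeg_box ((Finset.singleton_nonempty x).map (f := boxIncl h)))
  have h5 := det_dirMat_pos (killCond_comm boxCond_comm)
    (killCond_nonneg boxCond_nonneg hl.le) (netNondeg_killCond (c := boxCond N) boxCond_nonneg hl
      (A := Finset.insertNone {x}) ⟨none, by simp⟩)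
  have h6 := det_dirMat_pos boxCond_comm boxCond_nonneg
    (netNondeg_box (hne.map (f := boxIncl h)))
  have h7 := killErr_nonneg (N := N) hl
  rw [Fintype.card_coe] at h2
  exact div_le_mul_div_of_mul_le hl h6.le h4 h5 (pow_nonneg (by linarith) _) h1 h2 h3

/-! ### Probability that the tree contains given edges -/

theorem treeCount_empty {n : ℕ} (x : boxV n) :
    treeCount n ∅ = forestCount (boxV n) (boxEdges n) {x} := by
  unfold treeCount forestCount
  congr 1
  refine Finset.filter_congr fun T hT => ?_
  rw [Finset.mem_powerset] at hT
  simp only [IsBoxSpanningTree, IsRootedForest, Finset.mem_singleton, exists_eq_left,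
    Finset.card_singleton, Finset.empty_subset, and_true]
  refine ⟨fun h => ⟨fun y hy => h.2.1 y hy x x.2, h.2.2⟩, fun h => ⟨hT, fun y hy z hz => ?_, h.2⟩⟩
  exact Relation.ReflTransGen.trans (h.1 y hy) (connIn_symm (h.1 z hz))

theorem treeCount_le_forestCount {n : ℕ} {E : Finset (Sym2 V4)} {S : Finset (boxV n)}
    (hS : S.Nonempty) (hE : ∀ u w : V4, s(u, w) ∈ E → ∃ a ∈ S, (a : V4) = u)
    (hcard : E.card + 1 = S.card) :
    treeCount n E ≤ forestCount (boxV n) (boxEdges n) S := by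
  unfold treeCount forestCount
  refine Finset.card_le_card_of_injOn (fun T => T \ E) ?_ ?_
  · intro T hT
    simp only [Finset.coe_filter, Finset.mem_powerset, Set.mem_ofPred_eq] at hT ⊢
    obtain ⟨hTB, ⟨-, hconn, hTc⟩, hET⟩ := hT
    refine ⟨Finset.sdiff_subset.trans hTB, fun x hx => ?_, ?_⟩
    · obtain ⟨a, ha⟩ := hS
      have h1 := hconn x hx a a.2
      clear hx
      unfold connIn at h1
      induction h1 using Relation.ReflTransGen.head_induction_on with
      | refl => exact ⟨a, ha, Relation.ReflTransGen.refl⟩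
      | @head p q hpq _ ih =>
        by_cases he : s(p, q) ∈ E
        · obtain ⟨b, hb, rfl⟩ := hE p q he
          exact ⟨b, hb, Relation.ReflTransGen.refl⟩
        · obtain ⟨b, hb, hqb⟩ := ih
          refine ⟨b, hb, Relation.ReflTransGen.head ?_ hqb⟩
          simp only [Finset.mem_coe] at hpq
          simp [hpq, he]
    · have := Finset.card_sdiff_add_card_eq_card hET
      omega
  · intro T hT T' hT' h
    simp only [Finset.coe_filter, Finset.mem_powerset, Set.mem_ofPred_eq] at hT hT' h
    rw [← Finset.sdiff_union_of_subset hT.2.2, ← Finset.sdiff_union_of_subset hT'.2.2, h]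

theorem forestCount_box_eq_det {n : ℕ} (A : Finset (boxV n)) :
    (forestCount (boxV n) (boxEdges n) A : ℝ) = (dirMat (boxCond n) A).det :=
  forestCount_eq_det A fun _ _ h => ⟨(mk_mem_boxEdges.1 h).1, (mk_mem_boxEdges.1 h).2.1⟩

theorem ust_real_subset_le {Ω : Type*} [MeasurableSpace Ω] {P : Measure Ω}
    {𝔗 : Ω → Set (Sym2 V4)} (hUST : IsUST4 P 𝔗) {N : ℕ} {x : boxV N} {S : Finset (boxV N)}
    (hx : x ∈ S) {E : Finset (Sym2 V4)} (hE : ∀ u w : V4, s(u, w) ∈ E → ∃ a ∈ S, (a : V4) = u)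
    (hcard : E.card + 1 = S.card) {l : ℝ} (hl : 0 < l) :
    P.real {ω | (E : Set (Sym2 V4)) ⊆ 𝔗 ω} ≤ (1 + killErr N l) ^ E.card * (boxV N).card
      * ((dirMat (killCond (boxCond N) l) (Finset.insertNone S)).det
        / (dirMat (killCond (boxCond N) l) (Finset.insertNone {x})).det) := by
  obtain ⟨-, -, hlim⟩ := hUST
  refine le_of_tendsto (hlim E) ?_
  filter_upwards [eventually_ge_atTop N] with M hM
  have h1 := det_dirMat_box_div_le hM (S.erase x) (Finset.notMem_erase x S) hl
  rw [Finset.insert_erase hx, Finset.card_erase_of_mem hx, ← hcard, Nat.add_sub_cancel] at h1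
  refine le_trans ?_ h1
  have h2 : (treeCount M ∅ : ℝ) = (dirMat (boxCond M) (({x} : Finset (boxV N)).map (boxIncl hM))).det := by
    rw [treeCount_empty (boxIncl hM x), forestCount_box_eq_det, Finset.map_singleton]
  have h3 : (treeCount M E : ℝ) ≤ (dirMat (boxCond M) (S.map (boxIncl hM))).det := by
    rw [← forestCount_box_eq_det]
    refine Nat.cast_le.2 (treeCount_le_forestCount (Finset.Nonempty.map ⟨x, hx⟩) ?_ ?_)
    · intro u w h
      obtain ⟨a, ha, rfl⟩ := hE u w h
      exact ⟨boxIncl hM a, Finset.mem_map_of_mem _ ha, rfl⟩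
    · rw [Finset.card_map, hcard]
  rw [← h2]
  gcongr

/-! ### Exploration of self-avoiding paths -/

/-- There is a path in `T` of length at most `k` from `u` to `y` that stays in the box and avoids
`A`. -/
def AvoidConn {N : ℕ} (T : Set (Sym2 V4)) (y : boxV N) : ℕ → Finset (boxV N) → boxV N → Prop
  | 0, _, u => u = y
  | k + 1, A, u => u = y ∨ ∃ w, w ∉ insert u A ∧ s((u : V4), (w : V4)) ∈ boxEdges N ∧
      s((u : V4), (w : V4)) ∈ T ∧ AvoidConn T y k (insert u A) w

theorem ust_real_avoidConn_self_le {Ω : Type*} [MeasurableSpace Ω] {P : Measure Ω}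
    {𝔗 : Ω → Set (Sym2 V4)} (hUST : IsUST4 P 𝔗) {N : ℕ} {x : boxV N} {l : ℝ} (hl : 0 < l)
    (k : ℕ) (A : Finset (boxV N)) (u : boxV N) (hu : u ∉ A) (hx : x ∈ insert u A)
    (E : Finset (Sym2 V4)) (hE : ∀ v w : V4, s(v, w) ∈ E → ∃ a ∈ insert u A, (a : V4) = v)
    (hcard : E.card = A.card) :
    P.real {ω | (E : Set (Sym2 V4)) ⊆ 𝔗 ω ∧ AvoidConn (𝔗 ω) u k A u}
      ≤ (1 + killErr N l) ^ (A.card + k) * (boxV N).card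
        * ((dirMat (killCond (boxCond N) l) (Finset.insertNone A)).det
          / (dirMat (killCond (boxCond N) l) (Finset.insertNone {x})).det)
        * netGreen (killCond (boxCond N) l) (Finset.insertNone A) (some u) (some u) := by
  have := hUST.1
  have hc := killCond_comm (l := l) (boxCond_comm (N := N))
  have h0 := killCond_nonneg (boxCond_nonneg (N := N)) hl.le
  have hK : ∀ B : Finset (boxV N), NetNondeg (killCond (boxCond N) l) (Finset.insertNone B) :=
    fun B => netNondeg_killCond boxCond_nonneg hl ⟨none, by simp⟩
  have hdet : ∀ B : Finset (boxV N),
      0 < (dirMat (killCond (boxCond N) l) (Finset.insertNone B)).det :=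
    fun B => det_dirMat_pos hc h0 (hK B)
  have hε := killErr_nonneg (N := N) hl
  have hins : ∀ (B : Finset (boxV N)) (v : boxV N),
      Finset.insertNone (insert v B) = insert (some v) (Finset.insertNone B) := by
    intro B v
    ext o
    cases o <;> simp
  have h1 : P.real {ω | (E : Set (Sym2 V4)) ⊆ 𝔗 ω ∧ AvoidConn (𝔗 ω) u k A u}
      ≤ P.real {ω | (E : Set (Sym2 V4)) ⊆ 𝔗 ω} := measureReal_mono fun ω hω => hω.1
  have h2 := ust_real_subset_le hUST hx hE
    (by rw [hcard, Finset.card_insert_of_notMem hu]) hl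
  rw [hins, det_dirMat_insert (hdet A).ne', hcard] at h2
  have h3 : (1 + killErr N l) ^ A.card ≤ (1 + killErr N l) ^ (A.card + k) :=
    pow_le_pow_right₀ (by linarith) (by omega)
  have h4 := netGreen_self_pos hc h0 (hK A) (v := some u) (by simpa using hu)
  refine (h1.trans h2).trans ?_
  rw [mul_div_assoc, mul_comm (netGreen _ _ _ _), ← mul_assoc]
  have h5 : 0 ≤ (dirMat (killCond (boxCond N) l) (Finset.insertNone A)).det
        / (dirMat (killCond (boxCond N) l) (Finset.insertNone {x})).det :=
    div_nonneg (hdet _).le (hdet _).le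
  refine mul_le_mul_of_nonneg_right ?_ h4.le
  refine mul_le_mul_of_nonneg_right ?_ h5
  exact mul_le_mul_of_nonneg_right h3 (Nat.cast_nonneg _)

theorem ust_real_avoidConn_le {Ω : Type*} [MeasurableSpace Ω] {P : Measure Ω}
    {𝔗 : Ω → Set (Sym2 V4)} (hUST : IsUST4 P 𝔗) {N : ℕ} {x y : boxV N} {l : ℝ} (hl : 0 < l)
    (k : ℕ) (A : Finset (boxV N)) (u : boxV N) (hu : u ∉ A) (hy : y ∉ A) (hx : x ∈ insert u A)
    (E : Finset (Sym2 V4)) (hE : ∀ v w : V4, s(v, w) ∈ E → ∃ a ∈ insert u A, (a : V4) = v)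
    (hcard : E.card = A.card) :
    P.real {ω | (E : Set (Sym2 V4)) ⊆ 𝔗 ω ∧ AvoidConn (𝔗 ω) y k A u}
      ≤ (1 + killErr N l) ^ (A.card + k) * (boxV N).card
        * ((dirMat (killCond (boxCond N) l) (Finset.insertNone A)).det
          / (dirMat (killCond (boxCond N) l) (Finset.insertNone {x})).det)
        * netGreen (killCond (boxCond N) l) (Finset.insertNone A) (some y) (some u) := by
  have := hUST.1
  have hc := killCond_comm (l := l) (boxCond_comm (N := N))
  have h0 := killCond_nonneg (boxCond_nonneg (N := N)) hl.le
  have hK : ∀ B : Finset (boxV N), NetNondeg (killCond (boxCond N) l) (Finset.insertNone B) :=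
    fun B => netNondeg_killCond boxCond_nonneg hl ⟨none, by simp⟩
  have hdet : ∀ B : Finset (boxV N),
      0 < (dirMat (killCond (boxCond N) l) (Finset.insertNone B)).det :=
    fun B => det_dirMat_pos hc h0 (hK B)
  have hε := killErr_nonneg (N := N) hl
  have hins : ∀ (B : Finset (boxV N)) (v : boxV N),
      Finset.insertNone (insert v B) = insert (some v) (Finset.insertNone B) := by
    intro B v
    ext o
    cases o <;> simp
  induction k generalizing A u E with
  | zero =>
    by_cases huy : u = y
    · subst huy
      exact ust_real_avoidConn_self_le hUST hl 0 A u hu hx E hE hcard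
    · have h1 : {ω | (E : Set (Sym2 V4)) ⊆ 𝔗 ω ∧ AvoidConn (𝔗 ω) y 0 A u} = ∅ := by
        ext ω; simp [AvoidConn, huy]
      rw [h1, measureReal_empty]
      have h2 := netGreen_nonneg hc h0 (hK A) (v := some y) (by simpa using hy) (some u)
      have h3 := div_nonneg (hdet A).le (hdet {x}).le
      exact mul_nonneg (mul_nonneg (mul_nonneg (pow_nonneg (by linarith) _) (Nat.cast_nonneg _)) h3) h2
  | succ k ih =>
    by_cases huy : u = y
    · subst huy
      exact ust_real_avoidConn_self_le hUST hl (k + 1) A u hu hx E hE hcard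
    have hyu : y ∉ insert u A := by simp [hy, Ne.symm huy]
    set W := Finset.univ.filter fun w : boxV N =>
      w ∉ insert u A ∧ s((u : V4), (w : V4)) ∈ boxEdges N with hW
    set F := netGreen (killCond (boxCond N) l) (Finset.insertNone (insert u A)) (some y) with hF
    have hF0 : ∀ o, 0 ≤ F o :=
      fun o => netGreen_nonneg hc h0 (hK _) (v := some y) (by simpa using hyu) o
    set D := (dirMat (killCond (boxCond N) l) (Finset.insertNone {x})).det with hD
    set C := (1 + killErr N l) ^ (A.card + 1 + k) * ((boxV N).card : ℝ)
        * ((dirMat (killCond (boxCond N) l) (Finset.insertNone (insert u A))).det / D) with hC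
    have hC0 : 0 ≤ C := by
      have := div_nonneg (hdet (insert u A)).le (hdet {x}).le
      exact mul_nonneg (mul_nonneg (pow_nonneg (by linarith) _) (Nat.cast_nonneg _)) this
    have h1 : {ω | (E : Set (Sym2 V4)) ⊆ 𝔗 ω ∧ AvoidConn (𝔗 ω) y (k + 1) A u}
        ⊆ ⋃ w ∈ W, {ω | ((insert s((u : V4), (w : V4)) E : Finset (Sym2 V4)) : Set (Sym2 V4)) ⊆ 𝔗 ω
            ∧ AvoidConn (𝔗 ω) y k (insert u A) w} := by
      rintro ω ⟨hω, h | ⟨w, hw, hb, ht, hc⟩⟩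
      · exact absurd h huy
      · simp only [Set.mem_iUnion]
        refine ⟨w, by simpa [hW, hb] using hw, ?_, hc⟩
        rw [Finset.coe_insert]
        exact Set.insert_subset ht hω
    have h2 : ∀ w ∈ W, P.real {ω | ((insert s((u : V4), (w : V4)) E : Finset (Sym2 V4)) :
        Set (Sym2 V4)) ⊆ 𝔗 ω ∧ AvoidConn (𝔗 ω) y k (insert u A) w} ≤ C * F (some w) := by
      intro w hw
      obtain ⟨hwA, hwb⟩ := (Finset.mem_filter.1 hw).2
      have hnE : s((u : V4), (w : V4)) ∉ E := by
        intro h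
        rw [Sym2.eq_swap] at h
        obtain ⟨a, ha, haw⟩ := hE _ _ h
        exact hwA (Subtype.ext haw ▸ ha)
      have hcE : (insert s((u : V4), (w : V4)) E).card = (insert u A).card := by
        rw [Finset.card_insert_of_notMem hnE, Finset.card_insert_of_notMem hu, hcard]
      have hEE : ∀ p q : V4, s(p, q) ∈ insert s((u : V4), (w : V4)) E →
          ∃ a ∈ insert w (insert u A), (a : V4) = p := by
        intro p q hpq
        rcases Finset.mem_insert.1 hpq with h | h
        · rcases Sym2.eq_iff.1 h with ⟨rfl, -⟩ | ⟨rfl, -⟩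
          · exact ⟨u, by simp, rfl⟩
          · exact ⟨w, by simp, rfl⟩
        · obtain ⟨a, ha, hap⟩ := hE p q h
          exact ⟨a, Finset.mem_insert_of_mem ha, hap⟩
      have := ih (insert u A) w hwA hyu (Finset.mem_insert_of_mem hx) _ hEE hcE
      rwa [Finset.card_insert_of_notMem hu] at this
    have h3 : ∑ w ∈ W, F (some w) ≤ ∑ o, killCond (boxCond N) l (some u) o * F o := by
      rw [Fintype.sum_option, hW, Finset.sum_filter]
      refine le_trans ?_ (le_add_of_nonneg_left (mul_nonneg (h0 _ _) (hF0 _)))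
      refine Finset.sum_le_sum fun w _ => ?_
      split_ifs with h
      · simp [killCond, boxCond, edgeCond, h.2]
      · exact mul_nonneg (h0 _ _) (hF0 _)
    have h4 := netGreen_step (hdet A).ne' (by rw [← hins]; exact (hdet _).ne')
      (u := some u) (y := some y) (by simpa using hu) (by rw [← hins]; simpa using hyu)
    rw [← hins, ← hF] at h4
    have h5 := det_dirMat_insert (hdet A).ne' (some u)
    rw [← hins] at h5
    calc _ ≤ P.real (⋃ w ∈ W, _) := measureReal_mono h1 (measure_ne_top _ _)
      _ ≤ ∑ w ∈ W, _ := measureReal_biUnion_finset_le W _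
      _ ≤ ∑ w ∈ W, C * F (some w) := Finset.sum_le_sum h2
      _ = C * ∑ w ∈ W, F (some w) := by rw [Finset.mul_sum]
      _ ≤ C * ∑ o, killCond (boxCond N) l (some u) o * F o :=
          mul_le_mul_of_nonneg_left h3 hC0
      _ = _ := by
          rw [h4, hC, h5, add_right_comm, ← add_assoc]
          ring

theorem ust_real_avoidConn_empty_le {Ω : Type*} [MeasurableSpace Ω] {P : Measure Ω}
    {𝔗 : Ω → Set (Sym2 V4)} (hUST : IsUST4 P 𝔗) {N : ℕ} {l : ℝ} (hl : 0 < l)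
    (k : ℕ) (x y : boxV N) :
    P.real {ω | AvoidConn (𝔗 ω) y k ∅ x} ≤ (1 + killErr N l) ^ k * (boxV N).card * (8 + l)
        * netGreen (killCond (boxCond N) l) {none} (some y) (some x) := by
  have h1 := ust_real_avoidConn_le hUST hl k ∅ x (x := x) (y := y) (by simp) (by simp) (by simp)
    ∅ (by simp) (by simp)
  have hc := killCond_comm (l := l) (boxCond_comm (N := N))
  have h0 := killCond_nonneg (boxCond_nonneg (N := N)) hl.le
  have hK : NetNondeg (killCond (boxCond N) l) {none} :=
    netNondeg_killCond boxCond_nonneg hl ⟨none, by simp⟩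
  have hdet := det_dirMat_pos hc h0 hK
  have e1 : Finset.insertNone (∅ : Finset (boxV N)) = {none} := by
    ext o; cases o <;> simp
  have e2 : Finset.insertNone ({x} : Finset (boxV N)) = insert (some x) {none} := by
    ext o; cases o <;> simp
  simp only [Finset.coe_empty, Set.empty_subset, true_and, Finset.card_empty, zero_add, e1, e2]
    at h1
  rw [det_dirMat_insert hdet.ne'] at h1
  have h2 := netGreen_self_pos hc h0 hK (v := some x) (by simp)
  have h3 := one_le_netGreen_mul hc h0 hK (v := some x) (by simp) (d := 8 + l) (by
    rw [Fintype.sum_option, add_comm]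
    exact add_le_add (sum_edgeCond_boxEdges_le x) le_rfl)
  have h4 := netGreen_nonneg hc h0 hK (v := some y) (by simp) (some x)
  have hε := killErr_nonneg (N := N) hl
  refine h1.trans ?_
  refine mul_le_mul_of_nonneg_right ?_ h4
  refine mul_le_mul_of_nonneg_left ?_ (by positivity)
  rw [div_le_iff₀ (mul_pos h2 hdet)]
  nlinarith

/-! ### Exponential decay of the Green function of a killed network -/

theorem mul_sub_mul_sub_ge {a s t : ℝ} (ha : 0 ≤ a) (hst : |s - t| ≤ 1) (f g : ℝ) :
    -((Real.cosh a - 1) * ((Real.exp (a * s) * f) ^ 2 + (Real.exp (a * t) * g) ^ 2))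
      ≤ (Real.exp (a * s) ^ 2 * f - Real.exp (a * t) ^ 2 * g) * (f - g) := by
  set F := Real.exp (a * s) * f with hF
  set G := Real.exp (a * t) * g with hG
  have h1 : Real.cosh (a * (s - t)) ≤ Real.cosh a := by
    rw [Real.cosh_le_cosh, abs_mul, abs_of_nonneg ha]
    nlinarith
  have h2 : (Real.exp (a * s) ^ 2 * f - Real.exp (a * t) ^ 2 * g) * (f - g)
      = F ^ 2 + G ^ 2 - 2 * Real.cosh (a * (s - t)) * (F * G) := by
    have e1 : Real.exp (a * (s - t)) * Real.exp (a * t) = Real.exp (a * s) := by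
      rw [← Real.exp_add]; ring_nf
    have e2 : Real.exp (-(a * (s - t))) * Real.exp (a * s) = Real.exp (a * t) := by
      rw [← Real.exp_add]; ring_nf
    have e3 : Real.exp (a * (s - t)) * (F * G) = Real.exp (a * s) ^ 2 * f * g := by
      rw [← e1, hF, hG, ← e1]; ring
    have e4 : Real.exp (-(a * (s - t))) * (F * G) = Real.exp (a * t) ^ 2 * f * g := by
      rw [← e2, hF, hG, ← e2]; ring
    rw [Real.cosh_eq]
    have : 2 * ((Real.exp (a * (s - t)) + Real.exp (-(a * (s - t)))) / 2) * (F * G)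
        = Real.exp (a * s) ^ 2 * f * g + Real.exp (a * t) ^ 2 * f * g := by
      rw [← e3, ← e4]; ring
    rw [this, hF, hG]
    ring
  have h3 := Real.one_le_cosh (a * (s - t))
  rw [h2]
  nlinarith [sq_nonneg (F - G), sq_nonneg (F + G), sq_nonneg F, sq_nonneg G]

section Decay

variable {V : Type*} [Fintype V] {c : V → V → ℝ} {l : ℝ}

theorem sum_exp_mul_netLap_ge (hc : ∀ u w, c u w = c w u) (h0 : ∀ u w, 0 ≤ c u w)
    (hd : ∀ u, ∑ w, c u w ≤ 8) {ρ : V → ℝ} (hρ : ∀ u w, c u w ≠ 0 → |ρ u - ρ w| ≤ 1)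
    {a : ℝ} (ha : 0 ≤ a) (f : V → ℝ) :
    -(8 * (Real.cosh a - 1) * ∑ u, (Real.exp (a * ρ u) * f u) ^ 2)
      ≤ ∑ u, Real.exp (a * ρ u) ^ 2 * f u * netLap c f u := by
  rw [sum_mul_netLap hc (fun u => Real.exp (a * ρ u) ^ 2 * f u) f]
  set F : V → ℝ := fun u => (Real.exp (a * ρ u) * f u) ^ 2 with hF
  have hch := Real.one_le_cosh a
  have h1 : ∑ u, ∑ w, c u w * -((Real.cosh a - 1) * (F u + F w))
      ≤ ∑ u, ∑ w, c u w * ((Real.exp (a * ρ u) ^ 2 * f u - Real.exp (a * ρ w) ^ 2 * f w)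
        * (f u - f w)) := by
    refine Finset.sum_le_sum fun u _ => Finset.sum_le_sum fun w _ => ?_
    by_cases h : c u w = 0
    · simp [h]
    · exact mul_le_mul_of_nonneg_left (mul_sub_mul_sub_ge ha (hρ u w h) _ _) (h0 u w)
  have h2 : ∑ u, ∑ w, c u w * F u ≤ 8 * ∑ u, F u := by
    rw [Finset.mul_sum]
    refine Finset.sum_le_sum fun u _ => ?_
    rw [← Finset.sum_mul]
    exact mul_le_mul_of_nonneg_right (hd u) (sq_nonneg _)
  have h3 : ∑ u, ∑ w, c u w * F w = ∑ u, ∑ w, c u w * F u := by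
    rw [Finset.sum_comm]
    exact Finset.sum_congr rfl fun u _ => Finset.sum_congr rfl fun w _ => by rw [hc]
  have h4 : ∑ u, ∑ w, c u w * -((Real.cosh a - 1) * (F u + F w))
      = -((Real.cosh a - 1) * (2 * ∑ u, ∑ w, c u w * F u)) := by
    have : ∑ u, ∑ w, c u w * -((Real.cosh a - 1) * (F u + F w))
        = -((Real.cosh a - 1) * (∑ u, ∑ w, c u w * F u + ∑ u, ∑ w, c u w * F w)) := by
      simp only [← Finset.sum_add_distrib, Finset.mul_sum, ← Finset.sum_neg_distrib]
      exact Finset.sum_congr rfl fun u _ => Finset.sum_congr rfl fun w _ => by ring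
    rw [this, h3]; ring
  rw [h4] at h1
  have h5 : (Real.cosh a - 1) * (∑ u, ∑ w, c u w * F u) ≤ (Real.cosh a - 1) * (8 * ∑ u, F u) :=
    mul_le_mul_of_nonneg_left h2 (by linarith)
  linarith

variable [DecidableEq V]

theorem netGreen_killCond_le (hc : ∀ u w, c u w = c w u) (h0 : ∀ u w, 0 ≤ c u w)
    (hd : ∀ u, ∑ w, c u w ≤ 8) (hl : 0 < l) (hl1 : l ≤ 1) {ρ : V → ℝ}
    (hρ : ∀ u w, c u w ≠ 0 → |ρ u - ρ w| ≤ 1) (x y : V) (hy : ρ y = 0) :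
    netGreen (killCond c l) {none} (some y) (some x)
      ≤ 2 / l * Real.exp (-(Real.sqrt l / 4 * ρ x)) := by
  set a := Real.sqrt l / 4 with ha
  have ha0 : 0 ≤ a := by positivity
  have hsq : Real.sqrt l ^ 2 = l := Real.sq_sqrt hl.le
  have ha2 : a ^ 2 = l / 16 := by rw [ha, div_pow, hsq]; norm_num
  have hcosh : 8 * (Real.cosh a - 1) ≤ l / 2 := by
    have h1 := Real.cosh_le_exp_half_sq a
    have h2 := Real.abs_exp_sub_one_le (x := a ^ 2 / 2) (by
      rw [abs_of_nonneg (by positivity), ha2]; linarith)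
    rw [abs_of_nonneg (by positivity : 0 ≤ a ^ 2 / 2)] at h2
    have h3 := (le_abs_self _).trans h2
    rw [ha2] at h3 h1
    linarith
  have hK : NetNondeg (killCond c l) {none} := netNondeg_killCond h0 hl ⟨none, by simp⟩
  have hcK := killCond_comm (l := l) hc
  have hdet := hK.det_ne_zero hcK
  have hyn : some y ∉ ({none} : Finset (Option V)) := by simp
  set g := netGreen (killCond c l) {none} (some y) with hg
  have hgn : g none = 0 := netGreen_of_mem hdet hyn (by simp)
  set f : V → ℝ := fun u => g (some u) with hf
  have hen : netEnergy c f + l * ∑ u, f u ^ 2 = f y := by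
    have h1 := netEnergy_netGreen hcK hdet hyn
    rw [netEnergy_killCond, ← hg, hgn] at h1
    simpa using h1
  have hfy : f y * l ≤ 1 := by
    have h1 := netEnergy_nonneg h0 f
    have h2 := Finset.single_le_sum (f := fun u => f u ^ 2) (fun u _ => sq_nonneg _)
      (Finset.mem_univ y)
    have h3 : l * f y ^ 2 ≤ f y := by
      have := mul_le_mul_of_nonneg_left h2 hl.le
      linarith
    by_contra! h4
    have h5 : 0 < f y := by
      by_contra! h6
      nlinarith
    nlinarith
  have hLap : ∀ u, netLap c f u = (if u = y then 1 else 0) - l * f u := by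
    intro u
    have h1 := netLap_netGreen hdet (u := some u) (v := some y) (by simp)
    rw [← hg, netLap, Fintype.sum_option, hgn] at h1
    simp only [killCond, Option.some.injEq] at h1
    rw [netLap, ← h1]
    simp only [hf]
    ring
  have hmain := sum_exp_mul_netLap_ge hc h0 hd hρ ha0 f
  have hsum : ∑ u, Real.exp (a * ρ u) ^ 2 * f u * netLap c f u
      = f y - l * ∑ u, (Real.exp (a * ρ u) * f u) ^ 2 := by
    have : ∀ u, Real.exp (a * ρ u) ^ 2 * f u * netLap c f u
        = (if u = y then Real.exp (a * ρ u) ^ 2 * f u else 0)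
          - l * (Real.exp (a * ρ u) * f u) ^ 2 := by
      intro u
      rw [hLap]
      split_ifs <;> ring
    rw [Finset.sum_congr rfl fun u _ => this u, Finset.sum_sub_distrib, ← Finset.mul_sum]
    simp [hy]
  rw [hsum] at hmain
  have hS := Finset.single_le_sum (f := fun u => (Real.exp (a * ρ u) * f u) ^ 2)
    (fun u _ => sq_nonneg _) (Finset.mem_univ x)
  have hS0 : 0 ≤ ∑ u, (Real.exp (a * ρ u) * f u) ^ 2 := Finset.sum_nonneg fun _ _ => sq_nonneg _
  set S := ∑ u, (Real.exp (a * ρ u) * f u) ^ 2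
  have h1 : l / 2 * S ≤ f y := by nlinarith
  have h2 : (l * (Real.exp (a * ρ x) * f x)) ^ 2 ≤ 2 ^ 2 := by
    have h3 : l * (Real.exp (a * ρ x) * f x) ^ 2 ≤ l * S := mul_le_mul_of_nonneg_left hS hl.le
    have h4 : l * (l * (Real.exp (a * ρ x) * f x) ^ 2) ≤ l * (2 * f y) :=
      mul_le_mul_of_nonneg_left (by linarith) hl.le
    nlinarith
  have h5 : l * (Real.exp (a * ρ x) * f x) ≤ 2 := abs_le_of_sq_le_sq' h2 (by norm_num) |>.2
  have h6 : f x ≤ 2 / l * Real.exp (-(a * ρ x)) := by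
    rw [Real.exp_neg, ← div_eq_mul_inv, le_div_iff₀ (Real.exp_pos _), le_div_iff₀ hl]
    linarith
  exact h6

end Decay

/-! ### Crossings -/

theorem natAbs_le_extNorm (x : V4) (i : Fin 4) : (x i).natAbs ≤ extNorm x :=
  Finset.le_sup (f := fun i => (x i).natAbs) (Finset.mem_univ i)

theorem exists_natAbs_eq_extNorm (x : V4) : ∃ i, (x i).natAbs = extNorm x := by
  obtain ⟨i, -, hi⟩ := Finset.exists_mem_eq_sup Finset.univ Finset.univ_nonempty
    (fun i => (x i).natAbs)
  exact ⟨i, hi.symm⟩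

theorem mem_boxV_iff_extNorm_le {N : ℕ} {x : V4} : x ∈ boxV N ↔ extNorm x ≤ N := by
  rw [mem_boxV, extNorm, Finset.sup_le_iff]
  refine forall_congr' fun i => ?_
  simp only [Finset.mem_univ, true_imp_iff]
  omega

theorem abs_sub_le_one_of_latAdj {x y : V4} (h : latAdj x y) (i : Fin 4) : |x i - y i| ≤ 1 := by
  rw [← h]
  exact Finset.single_le_sum (f := fun i => |x i - y i|) (fun _ _ => abs_nonneg _)
    (Finset.mem_univ i)

theorem extNorm_le_of_latAdj {x y : V4} (h : latAdj x y) : extNorm y ≤ extNorm x + 1 := by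
  refine Finset.sup_le fun i _ => ?_
  have h1 := abs_le.1 (abs_sub_le_one_of_latAdj h i)
  have h2 := natAbs_le_extNorm x i
  omega

theorem avoidConn_of_walk {N : ℕ} {T : Set (Sym2 V4)} {y : boxV N} (k : ℕ) (A : Finset (boxV N))
    (m : ℕ) (hm : m ≤ k) (p : ℕ → boxV N) (hA : ∀ i ≤ m, p i ∉ A) (hy : p m = y)
    (hT : ∀ i < m, s((p i : V4), (p (i + 1) : V4)) ∈ T)
    (hB : ∀ i < m, s((p i : V4), (p (i + 1) : V4)) ∈ boxEdges N) :
    AvoidConn T y k A (p 0) := by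
  induction k generalizing A m p with
  | zero =>
    obtain rfl : m = 0 := by omega
    exact hy
  | succ k ih =>
    by_cases h0 : p 0 = y
    · exact Or.inl h0
    · set j := Nat.findGreatest (fun i => p i = p 0) m with hj
      have hj1 : p j = p 0 := Nat.findGreatest_spec (P := fun i => p i = p 0) (Nat.zero_le m) rfl
      have hj2 : j ≤ m := Nat.findGreatest_le m
      have hj3 : j < m := by
        rcases hj2.eq_or_lt with h | h
        · exact absurd (by rw [← hj1, h, hy]) h0
        · exact h
      have hj4 : ∀ i, j < i → i ≤ m → p i ≠ p 0 := fun i h1 h2 =>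
        Nat.findGreatest_is_greatest h1 h2
      have hav : ∀ i ≤ m - (j + 1), p (j + 1 + i) ∉ insert (p 0) A := by
        intro i hi h
        rcases Finset.mem_insert.1 h with h | h
        · exact hj4 _ (by omega) (by omega) h
        · exact hA _ (by omega) h
      refine Or.inr ⟨p (j + 1), hav 0 (by omega), ?_, ?_, ?_⟩
      · rw [← hj1]; exact hB j hj3
      · rw [← hj1]; exact hT j hj3
      · refine ih (insert (p 0) A) (m - (j + 1)) (by omega) (fun i => p (j + 1 + i)) hav ?_ ?_ ?_
        · simp only [← hy]; congr 1; omega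
        · intro i hi; exact hT (j + 1 + i) (by omega)
        · intro i hi; exact hB (j + 1 + i) (by omega)

theorem exists_avoidConn_of_crossEvent {T : Set (Sym2 V4)}
    (hT : ∀ x y : V4, s(x, y) ∈ T → latAdj x y) {r n N : ℕ} (hN : r + n ≤ N)
    (h : crossEvent T r n) :
    ∃ x y : boxV N, extNorm x = r ∧ extNorm y = 4 * r ∧ AvoidConn T y n ∅ x := by
  obtain ⟨m, p, hm, h0, h4, hp⟩ := h
  have hnorm : ∀ k ≤ m, extNorm (p k) ≤ r + k := by
    intro k
    induction k with
    | zero => intro _; rw [h0]; omega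
    | succ k ih =>
      intro hk
      have h1 := ih (by omega)
      have h2 := extNorm_le_of_latAdj (hT _ _ (hp k (by omega)))
      omega
  have hbox : ∀ k ≤ m, p k ∈ boxV N := fun k hk =>
    mem_boxV_iff_extNorm_le.2 ((hnorm k hk).trans (by omega))
  set q : ℕ → boxV N := fun k => ⟨p (min k m), hbox _ (min_le_right _ _)⟩ with hq
  have hq' : ∀ k ≤ m, (q k : V4) = p k := fun k hk => by simp [hq, hk]
  refine ⟨q 0, q m, by rw [hq' 0 (by omega), h0], by rw [hq' m le_rfl, h4],
    avoidConn_of_walk n ∅ m hm q (by simp) rfl ?_ ?_⟩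
  · intro i hi
    rw [hq' i hi.le, hq' (i + 1) hi]
    exact hp i hi
  · intro i hi
    exact mk_mem_boxEdges.2 ⟨(q i).2, (q (i + 1)).2, by
      rw [hq' i hi.le, hq' (i + 1) hi]; exact hT _ _ (hp i hi)⟩

section UST

variable {Ω : Type*} [MeasurableSpace Ω] {P : Measure Ω} {𝔗 : Ω → Set (Sym2 V4)}

theorem ust_ae_latAdj (hUST : IsUST4 P 𝔗) :
    ∀ᵐ ω ∂P, ∀ x y : V4, s(x, y) ∈ 𝔗 ω → latAdj x y := by
  have := hUST.1
  rw [ae_all_iff]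
  intro x
  rw [ae_all_iff]
  intro y
  by_cases h : latAdj x y
  · exact ae_of_all _ fun _ _ => h
  · have h1 := hUST.2.2 {s(x, y)}
    have h2 : ∀ n, treeCount n {s(x, y)} = 0 := by
      intro n
      rw [treeCount, Finset.card_eq_zero, Finset.filter_eq_empty_iff]
      rintro T hT ⟨-, hE⟩
      exact h (mk_mem_boxEdges.1 (Finset.mem_powerset.1 hT (hE (Finset.mem_singleton_self _)))).2.2
    simp only [h2, Nat.cast_zero, zero_div] at h1
    have h3 := tendsto_nhds_unique h1 tendsto_const_nhds
    rw [ENNReal.toReal_eq_zero_iff, or_iff_left (measure_ne_top P _)] at h3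
    rw [ae_iff]
    refine measure_mono_null (fun ω hω => ?_) h3
    simp only [Classical.not_imp, Set.mem_ofPred_eq] at hω
    simpa using hω.1

theorem card_boxV (N : ℕ) : (boxV N).card = (2 * N + 1) ^ 4 := by
  have : ((N : ℤ) + 1 + N).toNat = 2 * N + 1 := by omega
  simp [boxV, this]

theorem ust_real_avoidConn_le_exp (hUST : IsUST4 P 𝔗) {r n N : ℕ} {l : ℝ} (hl : 0 < l)
    (hl1 : l ≤ 1) {x y : boxV N} (hx : extNorm x = r) (hy : extNorm y = 4 * r) :
    P.real {ω | AvoidConn (𝔗 ω) y n ∅ x} ≤ (1 + killErr N l) ^ n * (boxV N).card * (18 / l)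
      * Real.exp (-(3 / 4 * Real.sqrt l * r)) := by
  obtain ⟨i, hi⟩ := exists_natAbs_eq_extNorm (y : V4)
  have hxi := natAbs_le_extNorm (x : V4) i
  set ρ : boxV N → ℝ := fun v => |((v : V4) i : ℝ) - ((y : V4) i : ℝ)| with hρ
  have h1 := netGreen_killCond_le (c := boxCond N) boxCond_comm boxCond_nonneg
    sum_edgeCond_boxEdges_le hl hl1 (ρ := ρ) (by
      intro u w huw
      have : latAdj u w := by
        by_contra h
        exact huw (by simp [boxCond, edgeCond, mk_mem_boxEdges, h])
      have h2 := abs_sub_le_one_of_latAdj this i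
      refine (abs_abs_sub_abs_le _ _).trans ?_
      rw [sub_sub_sub_cancel_right]
      exact_mod_cast h2) x y (by simp [hρ])
  have h2 : 3 * (r : ℝ) ≤ ρ x := by
    have : 3 * (r : ℤ) ≤ |(x : V4) i - (y : V4) i| := by
      rw [Int.abs_eq_natAbs]; omega
    simp only [hρ]
    exact_mod_cast this
  have h3 : Real.exp (-(Real.sqrt l / 4 * ρ x)) ≤ Real.exp (-(3 / 4 * Real.sqrt l * r)) := by
    rw [Real.exp_le_exp]
    have := mul_le_mul_of_nonneg_left h2 (Real.sqrt_nonneg l)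
    linarith
  have h4 := ust_real_avoidConn_empty_le hUST hl n x y
  have hε := killErr_nonneg (N := N) hl
  refine h4.trans ?_
  calc _ ≤ (1 + killErr N l) ^ n * (boxV N).card * (8 + l)
        * (2 / l * Real.exp (-(3 / 4 * Real.sqrt l * r))) :=
        mul_le_mul_of_nonneg_left (h1.trans (mul_le_mul_of_nonneg_left h3 (by positivity)))
          (by positivity)
    _ ≤ (1 + killErr N l) ^ n * (boxV N).card * 9
        * (2 / l * Real.exp (-(3 / 4 * Real.sqrt l * r))) := by
        gcongr; linarith
    _ = _ := by ring

theorem ust_real_crossEvent_le (hUST : IsUST4 P 𝔗) {r n N : ℕ} (hN : r + n ≤ N) {l : ℝ}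
    (hl : 0 < l) (hl1 : l ≤ 1) :
    P.real {ω | crossEvent (𝔗 ω) r n} ≤ (2 * N + 1) ^ 12 * (18 / l) * (1 + killErr N l) ^ n
      * Real.exp (-(3 / 4 * Real.sqrt l * r)) := by
  have := hUST.1
  set W := Finset.univ.filter fun q : boxV N × boxV N =>
    extNorm q.1 = r ∧ extNorm q.2 = 4 * r with hW
  set b := (1 + killErr N l) ^ n * (boxV N).card * (18 / l)
      * Real.exp (-(3 / 4 * Real.sqrt l * r)) with hb
  have hε := killErr_nonneg (N := N) hl
  have hb0 : 0 ≤ b := by positivity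
  have h1 : P.real {ω | crossEvent (𝔗 ω) r n}
      ≤ P.real (⋃ q ∈ W, {ω | AvoidConn (𝔗 ω) q.2 n ∅ q.1}) := by
    refine ENNReal.toReal_mono (measure_ne_top _ _) (measure_mono_ae ?_)
    filter_upwards [ust_ae_latAdj hUST] with ω hω hcross
    obtain ⟨x, y, hx, hy, hxy⟩ := exists_avoidConn_of_crossEvent hω hN hcross
    have : ω ∈ ⋃ q ∈ W, {ω | AvoidConn (𝔗 ω) q.2 n ∅ q.1} := by
      simp only [Set.mem_iUnion]
      exact ⟨(x, y), by simp [hW, hx, hy], hxy⟩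
    exact this
  calc _ ≤ _ := h1
    _ ≤ ∑ q ∈ W, _ := measureReal_biUnion_finset_le W _
    _ ≤ ∑ q ∈ W, b := Finset.sum_le_sum fun q hq =>
        ust_real_avoidConn_le_exp hUST hl hl1 (Finset.mem_filter.1 hq).2.1
          (Finset.mem_filter.1 hq).2.2
    _ ≤ ∑ _q : boxV N × boxV N, b :=
        Finset.sum_le_univ_sum_of_nonneg fun _ => hb0
    _ = _ := by
        rw [Finset.sum_const, Finset.card_univ, Fintype.card_prod, Fintype.card_coe, nsmul_eq_mul,
          hb, card_boxV]
        push_cast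
        ring

end UST

/-! ### Choice of the parameters -/

/-- `r` is large enough for the choice of parameters in the crossing estimate. -/
structure IsLargeRadius (d : ℝ) (r : ℕ) : Prop where
  five_le : 5 ≤ r
  le_log : 156 / d ≤ Real.log r
  log_pow_le : Real.log r ^ 4 ≤ r
  le_cast : 18 / d ^ 2 ≤ r

theorem eventually_isLargeRadius (d : ℝ) : ∀ᶠ r : ℕ in atTop, IsLargeRadius d r := by
  have hcast := tendsto_natCast_atTop_atTop (R := ℝ)
  have h1 := (Real.tendsto_log_atTop.comp hcast).eventually_ge_atTop (156 / d)
  have h2 := hcast.eventually_ge_atTop (18 / d ^ 2)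
  have h3 := hcast.eventually ((Real.isLittleO_pow_log_id_atTop (n := 4)).bound one_pos)
  filter_upwards [h1, h2, h3, eventually_ge_atTop 5] with r h1 h2 h3 h4
  refine ⟨h4, h1, ?_, h2⟩
  have := (Real.le_norm_self _).trans h3
  simpa using this

theorem log_four_mul_le {r : ℕ} (hr : 5 ≤ r) :
    Real.log (4 * (2 * (r : ℝ) ^ 2) + 2) ≤ 4 * Real.log r := by
  have hr' : (5 : ℝ) ≤ r := by exact_mod_cast hr
  have : 4 * Real.log r = Real.log ((r : ℝ) ^ 4) := by rw [Real.log_pow]; norm_num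
  rw [this]
  refine Real.log_le_log (by positivity) ?_
  nlinarith [mul_nonneg (sub_nonneg.2 hr') (sub_nonneg.2 hr'), pow_le_pow_left₀ (by norm_num) hr' 2]

theorem nat_ceil_mul_killErr_le {r : ℕ} {d : ℝ} (hd : d = 1 / 655360) (h : IsLargeRadius d r) :
    (⌈(r : ℝ) ^ 2 / Real.log r ^ 3⌉₊ : ℝ) *
        killErr (2 * r ^ 2) (d ^ 2 * Real.log r ^ 4 / (r : ℝ) ^ 2) ≤ d * Real.log r ^ 2 / 4 := by
  have hr : (5 : ℝ) ≤ r := by exact_mod_cast h.five_le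
  have hlog : 1 ≤ Real.log r := le_trans (by rw [hd]; norm_num) h.le_log
  have hlog4 := h.log_pow_le
  set L := Real.log r with hL
  have hn : (⌈(r : ℝ) ^ 2 / L ^ 3⌉₊ : ℝ) ≤ 2 * ((r : ℝ) ^ 2 / L ^ 3) := by
    refine (Nat.ceil_lt_add_one (by positivity)).le.trans ?_
    have : 1 ≤ (r : ℝ) ^ 2 / L ^ 3 := by
      rw [one_le_div (by positivity)]
      calc L ^ 3 ≤ L ^ 4 := pow_le_pow_right₀ hlog (by norm_num)
        _ ≤ r := hlog4
        _ ≤ (r : ℝ) ^ 2 := by nlinarith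
    linarith
  have hkill : killErr (2 * r ^ 2) (d ^ 2 * L ^ 4 / (r : ℝ) ^ 2)
      ≤ 32 * (d ^ 2 * L ^ 4 / (r : ℝ) ^ 2) * (512 * (5 * L)) := by
    have := log_four_mul_le h.five_le
    unfold killErr boxConst
    push_cast
    gcongr
    linarith
  calc _ ≤ 2 * ((r : ℝ) ^ 2 / L ^ 3) * (32 * (d ^ 2 * L ^ 4 / (r : ℝ) ^ 2) * (512 * (5 * L))) :=
        mul_le_mul hn hkill (killErr_nonneg (by rw [hd]; positivity)) (by positivity)
    _ = 163840 * d ^ 2 * L ^ 2 := by field_simp; ring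
    _ = d * L ^ 2 / 4 := by rw [hd]; ring

theorem polynomial_prefactor_le {r : ℕ} {d : ℝ} (hd : 0 < d) (hd1 : d ≤ 1)
    (h : IsLargeRadius d r) :
    (2 * (2 * (r : ℝ) ^ 2) + 1) ^ 12 * (18 / (d ^ 2 * Real.log r ^ 4 / (r : ℝ) ^ 2))
      ≤ Real.exp (d * Real.log r ^ 2 / 4) := by
  have hr : (5 : ℝ) ≤ r := by exact_mod_cast h.five_le
  have hL := h.le_log
  have h156 : 156 ≤ d * Real.log r := by rwa [div_le_iff₀' hd] at hL
  have hlog : 1 ≤ Real.log r := by nlinarith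
  have h1 : 2 * (2 * (r : ℝ) ^ 2) + 1 ≤ (r : ℝ) ^ 3 := by
    nlinarith [mul_le_mul_of_nonneg_right hr (sq_nonneg (r : ℝ))]
  have h2 : 18 / (d ^ 2 * Real.log r ^ 4 / (r : ℝ) ^ 2) ≤ (r : ℝ) ^ 3 := by
    calc _ = 18 / d ^ 2 * (r : ℝ) ^ 2 / Real.log r ^ 4 := by field_simp
      _ ≤ 18 / d ^ 2 * (r : ℝ) ^ 2 := div_le_self (by positivity) (one_le_pow₀ hlog)
      _ ≤ r * (r : ℝ) ^ 2 := by gcongr; exact h.le_cast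
      _ = _ := by ring
  calc _ ≤ ((r : ℝ) ^ 3) ^ 12 * (r : ℝ) ^ 3 := by gcongr
    _ = Real.exp (39 * Real.log r) := by
        rw [← Real.exp_log (show (0 : ℝ) < r by linarith), ← Real.exp_nat_mul, ← Real.exp_nat_mul,
          ← Real.exp_add, Real.log_exp]
        push_cast
        ring_nf
    _ ≤ _ := by
        refine Real.exp_le_exp.2 ?_
        nlinarith

theorem ust_real_crossEvent_le_exp {Ω : Type*} [MeasurableSpace Ω] {P : Measure Ω}
    {𝔗 : Ω → Set (Sym2 V4)} (hUST : IsUST4 P 𝔗) {r : ℕ} {d : ℝ} (hd : d = 1 / 655360)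
    (h : IsLargeRadius d r) :
    P.real {ω | crossEvent (𝔗 ω) r ⌈(r : ℝ) ^ 2 / Real.log r ^ 3⌉₊}
      ≤ Real.exp (-(d / 4) * Real.log r ^ 2) := by
  have hr : (5 : ℝ) ≤ r := by exact_mod_cast h.five_le
  have hd0 : 0 < d := by rw [hd]; norm_num
  have hd1 : d ≤ 1 := by rw [hd]; norm_num
  have hlog : 1 ≤ Real.log r := le_trans (by rw [hd]; norm_num) h.le_log
  have hpre := polynomial_prefactor_le hd0 hd1 h
  have hkill := nat_ceil_mul_killErr_le hd h
  have hlog4 := h.log_pow_le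
  set L := Real.log r with hL
  set n := ⌈(r : ℝ) ^ 2 / L ^ 3⌉₊ with hn
  set l := d ^ 2 * L ^ 4 / (r : ℝ) ^ 2 with hl
  have hl0 : 0 < l := by positivity
  have hl1 : l ≤ 1 := by
    rw [hl, div_le_one (by positivity)]
    calc d ^ 2 * L ^ 4 ≤ 1 * r := by gcongr; exact pow_le_one₀ hd0.le hd1
      _ ≤ (r : ℝ) ^ 2 := by nlinarith
  have hN : r + n ≤ 2 * r ^ 2 := by
    have h1 : (n : ℝ) ≤ (r : ℝ) ^ 2 + 1 :=
      (Nat.ceil_lt_add_one (by positivity)).le.trans <| by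
        gcongr
        exact div_le_self (by positivity) (one_le_pow₀ hlog)
    have : ((r + n : ℕ) : ℝ) ≤ (2 * r ^ 2 : ℕ) := by push_cast; nlinarith
    exact_mod_cast this
  have hsqrt : Real.sqrt l * r = d * L ^ 2 := by
    have : l = (d * L ^ 2 / r) ^ 2 := by rw [hl]; ring
    rw [this, Real.sqrt_sq (by positivity)]
    field_simp
  have hε := killErr_nonneg (N := 2 * r ^ 2) hl0
  have hpow : (1 + killErr (2 * r ^ 2) l) ^ n ≤ Real.exp (d * L ^ 2 / 4) := by
    calc _ ≤ Real.exp (killErr (2 * r ^ 2) l) ^ n := by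
          gcongr
          rw [add_comm]
          exact Real.add_one_le_exp _
      _ = Real.exp (n * killErr (2 * r ^ 2) l) := (Real.exp_nat_mul _ _).symm
      _ ≤ _ := Real.exp_le_exp.2 hkill
  have hmain := ust_real_crossEvent_le hUST hN hl0 hl1
  push_cast at hmain
  calc _ ≤ _ := hmain
    _ ≤ Real.exp (d * L ^ 2 / 4) * Real.exp (d * L ^ 2 / 4)
          * Real.exp (-(3 / 4 * (d * L ^ 2))) := by
        rw [mul_assoc (3 / 4 : ℝ), hsqrt]
        gcongr
    _ = _ := by
        rw [← Real.exp_add, ← Real.exp_add]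
        ring_nf

/-- **Short annulus crossings are very unlikely** (Lemma 2.8): the probability that the 4d UST
contains a path from `∂Λ(r)` to `∂Λ(4r)` of length at most `⌈r²(log r)^{-3}⌉` is
`exp[-Ω((log r)²)]` as `r → ∞`. -/
theorem ust_annulus_crossing
    {Ω : Type*} [MeasurableSpace Ω] (P : Measure Ω) (𝔗 : Ω → Set (Sym2 V4))
    (hUST : IsUST4 P 𝔗) :
    ∃ c : ℝ, 0 < c ∧ ∃ r₀ : ℕ, ∀ r : ℕ, r₀ ≤ r →
      P {ω | crossEvent (𝔗 ω) r ⌈(r : ℝ) ^ 2 / Real.log r ^ 3⌉₊} ≤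
        ENNReal.ofReal (Real.exp (-c * Real.log r ^ 2)) := by
  have := hUST.1
  obtain ⟨r₀, hr₀⟩ := eventually_atTop.1 (eventually_isLargeRadius (1 / 655360))
  refine ⟨1 / 655360 / 4, by norm_num, r₀, fun r hr => ?_⟩
  rw [ENNReal.le_ofReal_iff_toReal_le (measure_ne_top _ _) (Real.exp_pos _).le]
  exact ust_real_crossEvent_le_exp hUST rfl (hr₀ r hr)
end
end

section
/- Let S be a finite subset of Z^4 and let r ≥ 1. Then there exist an integer K and points x_1, …, x_K ∈ S + Λ(r) such that the boxes Λ(x_i, 3r), 1 ≤ i ≤ K, are pairwise disjoint, Σ_{i=1}^K Cap(S ∩ Λ(x_i, r)) ≥ 3^{-4} · Cap(S), and Σ_{i=1}^K Cap(S ∩ Λ(x_i, 3r)) ≤ 15⁴ · Σ_{i=1}^K Cap(S ∩ Λ(x_i, r)). -/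
open MeasureTheory Filter Set
open scoped ENNReal Classical Topology

noncomputable section

/-- The lattice neighbours of `y` in `ℤ⁴`. -/
def latNbrs (y : V4) : Finset V4 :=
  Finset.univ.image fun p : Fin 4 × Bool =>
    Function.update y p.1 (y p.1 + if p.2 then 1 else -1)

/-- The number of `n`-step nearest-neighbour paths started at `a` whose positions at
times `1,…,n` all avoid `A`. -/
def avoidCount (A : Set V4) : ℕ → V4 → ℕ
  | 0, _ => 1
  | n + 1, a => ∑ b ∈ (latNbrs a).filter (fun b => b ∉ A), avoidCount A n b

/-- The probability that the simple random walk on `ℤ⁴` started at `a` never returns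
to `A` after time zero. -/
def escProb (A : Set V4) (a : V4) : ℝ := ⨅ n : ℕ, (avoidCount A n a : ℝ) / 8 ^ n

/-- The capacity of `A ⊆ ℤ⁴`: `Cap(A) = Σ_{a∈A} deg(a) P_a(no return to A)`. -/
def cap4 (A : Set V4) : ℝ := ∑' a : A, 8 * escProb A a

/-- The number of `n`-step nearest-neighbour paths started at `x` which visit `S` by
time `n`. -/
def hitCount (S : Set V4) : ℕ → V4 → ℕ
  | 0, x => if x ∈ S then 1 else 0
  | n + 1, x => if x ∈ S then 8 ^ (n + 1) else ∑ b ∈ latNbrs x, hitCount S n b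

/-- The probability that the simple random walk on `ℤ⁴` started at `x` ever hits `S`. -/
def hitProb (S : Set V4) (x : V4) : ℝ := ⨆ n : ℕ, (hitCount S n x : ℝ) / 8 ^ n

/-- The `ℓ∞` ball of radius `r ∈ ℕ` around `x` in `ℤ⁴`, as a set. -/
def boxSet (x : V4) (r : ℕ) : Set V4 := {y | ∀ i, |y i - x i| ≤ (r : ℤ)}

/-- The `ℓ∞` ball of radius `r ∈ ℕ` around `x` in `ℤ⁴`, as a finset. -/
def boxFinset (x : V4) (r : ℕ) : Finset V4 :=
  Fintype.piFinset fun i => Finset.Icc (x i - r) (x i + r)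

lemma avoidCount_anti {A B : Set V4} (h : A ⊆ B) (n : ℕ) (a : V4) :
    avoidCount B n a ≤ avoidCount A n a := by
  induction n generalizing a with
  | zero => simp [avoidCount]
  | succ n ih =>
    simp only [avoidCount]
    refine (Finset.sum_le_sum fun b _ => ih b).trans ?_
    refine Finset.sum_le_sum_of_subset fun b hb => ?_
    simp only [Finset.mem_filter] at hb ⊢
    exact ⟨hb.1, fun hA => hb.2 (h hA)⟩

lemma escProb_nonneg (A : Set V4) (a : V4) : 0 ≤ escProb A a :=
  Real.iInf_nonneg fun _ => by positivity

lemma escProb_anti {A B : Set V4} (h : A ⊆ B) (a : V4) : escProb B a ≤ escProb A a := by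
  refine ciInf_mono ⟨0, ?_⟩ fun n => ?_
  · rintro _ ⟨n, rfl⟩
    positivity
  · have := avoidCount_anti h n a
    gcongr

lemma cap4_nonneg (A : Set V4) : 0 ≤ cap4 A :=
  tsum_nonneg fun a => mul_nonneg (by norm_num) (escProb_nonneg A a)

lemma cap4_empty : cap4 ∅ = 0 := by
  simp [cap4]

lemma cap4_eq_sum_ite {A C : Set V4} (hA : A.Finite) :
    cap4 (A ∩ C) = ∑ a ∈ hA.toFinset, if a ∈ C then 8 * escProb (A ∩ C) a else 0 := by
  rw [cap4, tsum_subtype (A ∩ C) fun a => 8 * escProb (A ∩ C) a,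
    tsum_eq_sum (s := hA.toFinset)]
  · refine Finset.sum_congr rfl fun a ha => ?_
    have : a ∈ A := hA.mem_toFinset.1 ha
    simp [Set.indicator_apply, this]
  · intro a ha
    exact Set.indicator_of_notMem (fun h => ha (hA.mem_toFinset.2 h.1)) _

/-- Subadditivity of the capacity along a finite cover. -/
lemma cap4_le_sum_inter {ι : Type*} {A : Set V4} (hA : A.Finite) (F : Finset ι)
    (B : ι → Set V4) (hB : ∀ a ∈ A, ∃ i ∈ F, a ∈ B i) :
    cap4 A ≤ ∑ i ∈ F, cap4 (A ∩ B i) := by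
  have h0 : ∀ i a, 0 ≤ if a ∈ B i then 8 * escProb (A ∩ B i) a else 0 := fun i a => by
    split_ifs
    · exact mul_nonneg (by norm_num) (escProb_nonneg _ _)
    · exact le_rfl
  have hA' : cap4 A = ∑ a ∈ hA.toFinset, 8 * escProb A a := by
    simpa using cap4_eq_sum_ite (C := Set.univ) hA
  rw [hA', Finset.sum_congr rfl fun i _ => cap4_eq_sum_ite (C := B i) hA, Finset.sum_comm]
  refine Finset.sum_le_sum fun a ha => ?_
  obtain ⟨i, hi, hai⟩ := hB a (hA.mem_toFinset.1 ha)
  refine le_trans ?_ (Finset.single_le_sum (fun i _ => h0 i a) hi)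
  rw [if_pos hai]
  have := escProb_anti (Set.inter_subset_left : A ∩ B i ⊆ A) a
  linarith

/-- The point of the sublattice `t + (6r+3)ℤ⁴` with index `n`. -/
def gridPoint (r : ℕ) (t n : V4) : V4 := fun i => t i + (6 * r + 3) * n i

/-- The total capacity of the pieces of `S` in the boxes of radius `r` centred on the
sublattice `t + (6r+3)ℤ⁴`. -/
def gridCap (S : Set V4) (r : ℕ) (t : V4) : ℝ :=
  ∑' n : V4, cap4 (S ∩ boxSet (gridPoint r t n) r)

lemma boxSet_mono (x : V4) {r s : ℕ} (h : r ≤ s) : boxSet x r ⊆ boxSet x s :=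
  fun _ hy i => (hy i).trans (by exact_mod_cast h)

lemma eq_of_mem_boxSet_gridPoint {r : ℕ} {t n m y : V4}
    (hn : y ∈ boxSet (gridPoint r t n) (3 * r)) (hm : y ∈ boxSet (gridPoint r t m) (3 * r)) :
    n = m := by
  funext i
  have h1 := abs_le.1 (hn i)
  have h2 := abs_le.1 (hm i)
  simp only [gridPoint] at h1 h2
  push_cast at h1 h2
  have hr : (0 : ℤ) ≤ r := Int.natCast_nonneg r
  rcases lt_trichotomy (n i) (m i) with h | h | h
  · nlinarith
  · exact h
  · nlinarith

lemma finite_gridPoint_meets {S : Set V4} (hS : S.Finite) (r : ℕ) (t : V4) :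
    {n | (S ∩ boxSet (gridPoint r t n) r).Nonempty}.Finite := by
  have hr : r ≤ 3 * r := by omega
  refine (hS.biUnion (t := fun s => {n | s ∈ boxSet (gridPoint r t n) r})
    fun s _ => Set.Subsingleton.finite fun n hn m hm => ?_).subset ?_
  · exact eq_of_mem_boxSet_gridPoint (boxSet_mono _ hr hn) (boxSet_mono _ hr hm)
  · rintro n ⟨s, hs, hsn⟩
    exact Set.mem_biUnion hs hsn

lemma cap4_eq_zero_of_not_meets {S : Set V4} {r : ℕ} {t n : V4}
    (h : ¬(S ∩ boxSet (gridPoint r t n) r).Nonempty) :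
    cap4 (S ∩ boxSet (gridPoint r t n) r) = 0 := by
  rw [Set.not_nonempty_iff_eq_empty.1 h, cap4_empty]

lemma gridCap_eq_sum {S : Set V4} (hS : S.Finite) (r : ℕ) (t : V4) :
    gridCap S r t = ∑ n ∈ (finite_gridPoint_meets hS r t).toFinset,
      cap4 (S ∩ boxSet (gridPoint r t n) r) :=
  tsum_eq_sum fun _ hn =>
    cap4_eq_zero_of_not_meets fun h => hn ((Set.Finite.mem_toFinset _).2 h)

lemma sum_le_gridCap {S : Set V4} (hS : S.Finite) (r : ℕ) (t : V4) (F : Finset V4) :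
    ∑ n ∈ F, cap4 (S ∩ boxSet (gridPoint r t n) r) ≤ gridCap S r t := by
  refine Summable.sum_le_tsum F (fun n _ => cap4_nonneg _) ?_
  exact summable_of_ne_finset_zero (s := (finite_gridPoint_meets hS r t).toFinset) fun _ hn =>
    cap4_eq_zero_of_not_meets fun h => hn ((Set.Finite.mem_toFinset _).2 h)

lemma gridCap_gridPoint (S : Set V4) (r : ℕ) (t m : V4) :
    gridCap S r (gridPoint r t m) = gridCap S r t := by
  rw [gridCap, gridCap,
    ← (Equiv.addLeft m).tsum_eq fun n => cap4 (S ∩ boxSet (gridPoint r t n) r)]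
  refine tsum_congr fun n => ?_
  have : gridPoint r (gridPoint r t m) n = gridPoint r t (m + n) := by
    funext i
    simp only [gridPoint, Pi.add_apply]
    ring
  simp [this]

lemma exists_forall_gridCap_le (S : Set V4) (r : ℕ) :
    ∃ t, ∀ s, gridCap S r s ≤ gridCap S r t := by
  have hM : (0 : ℤ) < 6 * r + 3 := by positivity
  obtain ⟨t, -, ht⟩ := Finset.exists_max_image
    (Fintype.piFinset fun _ : Fin 4 => Finset.Ico (0 : ℤ) (6 * r + 3)) (gridCap S r)
    ⟨0, by simp [hM]⟩
  refine ⟨t, fun s => ?_⟩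
  have hs : gridPoint r (fun i => s i % (6 * r + 3)) (fun i => s i / (6 * r + 3)) = s :=
    funext fun i => Int.emod_add_mul_ediv (s i) _
  rw [← hs, gridCap_gridPoint]
  refine ht _ ?_
  simp only [Fintype.mem_piFinset, Finset.mem_Ico]
  exact fun i => ⟨Int.emod_nonneg _ hM.ne', Int.emod_lt_of_pos _ hM⟩

lemma cap4_le_sum_gridCap {ι : Type*} [Fintype ι] {S : Set V4} (hS : S.Finite) (r : ℕ)
    (c : ι → V4) (hc : ∀ s, ∃ j n, s ∈ boxSet (gridPoint r (c j) n) r) :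
    cap4 S ≤ ∑ j, gridCap S r (c j) := by
  choose j n hjn using hc
  calc cap4 S ≤ ∑ q ∈ Finset.univ ×ˢ hS.toFinset.image n,
        cap4 (S ∩ boxSet (gridPoint r (c q.1) q.2) r) :=
        cap4_le_sum_inter hS _ (fun q : ι × V4 => boxSet (gridPoint r (c q.1) q.2) r)
          fun s hs => ⟨(j s, n s), Finset.mem_product.2 ⟨Finset.mem_univ _,
            Finset.mem_image_of_mem n (hS.mem_toFinset.2 hs)⟩, hjn s⟩
    _ = ∑ i, ∑ m ∈ hS.toFinset.image n, cap4 (S ∩ boxSet (gridPoint r (c i) m) r) :=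
        Finset.sum_product _ _ _
    _ ≤ _ := Finset.sum_le_sum fun i _ => sum_le_gridCap hS r _ _

/-- The boxes of radius `r` centred on `3⁴` translates of the sublattice cover `ℤ⁴`. -/
lemma exists_mem_boxSet_gridPoint (r : ℕ) (s : V4) :
    ∃ (j : Fin 4 → Fin 3) (n : V4),
      s ∈ boxSet (gridPoint r (fun i => (2 * r + 1) * (j i : ℤ)) n) r := by
  have hcoord : ∀ i, ∃ (j : Fin 3) (n : ℤ),
      |s i - ((2 * r + 1) * (j : ℤ) + (6 * r + 3) * n)| ≤ (r : ℤ) := by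
    intro i
    have hN : (0 : ℤ) < 2 * r + 1 := by positivity
    have h1 := Int.emod_add_mul_ediv (s i + r) (2 * r + 1)
    have h2 := Int.emod_nonneg (s i + r) hN.ne'
    have h3 := Int.emod_lt_of_pos (s i + r) hN
    have h4 := Int.emod_add_mul_ediv ((s i + r) / (2 * r + 1)) 3
    generalize (s i + r) / (2 * r + 1) = q at *
    have h5 : 0 ≤ q % 3 := by omega
    have h6 : q % 3 < 3 := by omega
    refine ⟨⟨(q % 3).toNat, by omega⟩, q / 3, ?_⟩
    have h7 : (2 * r + 1) * (((q % 3).toNat : ℕ) : ℤ) + (6 * r + 3) * (q / 3)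
        = (2 * r + 1) * q := by
      rw [Int.toNat_of_nonneg h5]
      linear_combination (2 * (r : ℤ) + 1) * h4
    simp only [h7]
    rw [abs_le]
    constructor <;> linarith
  choose j n h using hcoord
  exact ⟨j, n, h⟩

/-- A box of radius `3r` is covered by `3⁴` boxes of radius `r`. -/
lemma cap4_inter_boxSet_le {S : Set V4} (hS : S.Finite) (r : ℕ) (x : V4) :
    cap4 (S ∩ boxSet x (3 * r)) ≤ ∑ j : Fin 4 → Fin 3,
      cap4 (S ∩ boxSet (fun i => x i + 2 * r * ((j i : ℤ) - 1)) r) := by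
  have hsub : ∀ j : Fin 4 → Fin 3,
      boxSet (fun i => x i + 2 * r * ((j i : ℤ) - 1)) r ⊆ boxSet x (3 * r) := by
    intro j y hy i
    have h : |y i - (x i + 2 * r * ((j i : ℤ) - 1))| ≤ (r : ℤ) := hy i
    generalize j i = k at h
    rw [abs_le] at h ⊢
    push_cast
    fin_cases k <;> simp at h <;> constructor <;> linarith
  refine (cap4_le_sum_inter (hS.inter_of_left _) Finset.univ
    (fun j : Fin 4 → Fin 3 => boxSet (fun i => x i + 2 * r * ((j i : ℤ) - 1)) r) ?_).trans_eq ?_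
  · rintro y ⟨-, hy⟩
    have hcoord : ∀ i, ∃ k : Fin 3, |y i - (x i + 2 * r * ((k : ℤ) - 1))| ≤ (r : ℤ) := by
      intro i
      have h := abs_le.1 (hy i)
      push_cast at h
      rcases le_total (y i - x i) (-r) with h1 | h1
      · exact ⟨0, by rw [abs_le]; constructor <;> simp <;> linarith⟩
      rcases le_total (y i - x i) r with h2 | h2
      · exact ⟨1, by rw [abs_le]; constructor <;> simp <;> linarith⟩
      · exact ⟨2, by rw [abs_le]; constructor <;> simp <;> linarith⟩
    choose j hj using hcoord
    exact ⟨j, Finset.mem_univ _, hj⟩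
  · refine Finset.sum_congr rfl fun j _ => ?_
    rw [Set.inter_assoc, Set.inter_eq_right.2 (hsub j)]

lemma sum_cap4_inter_boxSet_three_mul_le {S : Set V4} (hS : S.Finite) (r : ℕ) (t : V4)
    (F : Finset V4) :
    ∑ n ∈ F, cap4 (S ∩ boxSet (gridPoint r t n) (3 * r)) ≤
      ∑ j : Fin 4 → Fin 3, gridCap S r fun i => t i + 2 * r * ((j i : ℤ) - 1) := by
  refine (Finset.sum_le_sum fun n _ => cap4_inter_boxSet_le hS r _).trans ?_
  rw [Finset.sum_comm]
  refine Finset.sum_le_sum fun j _ => le_trans (le_of_eq ?_) (sum_le_gridCap hS r _ F)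
  refine Finset.sum_congr rfl fun n _ => ?_
  congr 3
  funext i
  simp only [gridPoint]
  ring

/-- **Covering lemma for the capacity** (Lemma 2.12): for every finite `S ⊆ ℤ⁴` and `r ≥ 1`
there are points `x_1,…,x_K ∈ S + Λ(r)` with pairwise disjoint boxes `Λ(x_i,3r)` such that
`Σ_i Cap(S ∩ Λ(x_i,r)) ≥ 3^{-4} Cap(S)` and
`Σ_i Cap(S ∩ Λ(x_i,3r)) ≤ 15⁴ Σ_i Cap(S ∩ Λ(x_i,r))`. -/
theorem capacity_covering_lemma (S : Set V4) (hS : S.Finite) (r : ℕ) (hr : 1 ≤ r) :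
    ∃ (K : ℕ) (x : Fin K → V4),
      (∀ i, ∃ s ∈ S, x i ∈ boxSet s r) ∧
      (∀ i j, i ≠ j → Disjoint (boxSet (x i) (3 * r)) (boxSet (x j) (3 * r))) ∧
      ((3 : ℝ) ^ (4 : ℕ))⁻¹ * cap4 S ≤ ∑ i, cap4 (S ∩ boxSet (x i) r) ∧
      ∑ i, cap4 (S ∩ boxSet (x i) (3 * r)) ≤
        (15 : ℝ) ^ (4 : ℕ) * ∑ i, cap4 (S ∩ boxSet (x i) r) := by
  obtain ⟨t, ht⟩ := exists_forall_gridCap_le S r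
  have hsum : ∀ f : (Fin 4 → Fin 3) → V4, ∑ j, gridCap S r (f j) ≤ 81 * gridCap S r t :=
    fun f => (Finset.sum_le_sum fun j _ => ht (f j)).trans_eq (by norm_num)
  set P := (finite_gridPoint_meets hS r t).toFinset
  have hreindex : ∀ f : V4 → ℝ, ∑ i, f (P.equivFin.symm i) = ∑ n ∈ P, f n := fun f => by
    rw [P.equivFin.symm.sum_comp fun n : P => f n, Finset.sum_coe_sort]
  refine ⟨P.card, fun i => gridPoint r t (P.equivFin.symm i), fun i => ?_, fun i j hij => ?_,
    ?_, ?_⟩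
  · obtain ⟨s, hs, hsx⟩ := (Set.Finite.mem_toFinset _).1 (P.equivFin.symm i).2
    exact ⟨s, hs, fun k => by rw [abs_sub_comm]; exact hsx k⟩
  · rw [Set.disjoint_left]
    exact fun y hy hy' => hij (P.equivFin.symm.injective
      (Subtype.ext (eq_of_mem_boxSet_gridPoint hy hy')))
  · rw [hreindex fun n => cap4 (S ∩ boxSet (gridPoint r t n) r), ← gridCap_eq_sum hS]
    have := (cap4_le_sum_gridCap hS r _ (exists_mem_boxSet_gridPoint r)).trans (hsum _)
    linarith
  · rw [hreindex fun n => cap4 (S ∩ boxSet (gridPoint r t n) r), ← gridCap_eq_sum hS,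
      hreindex fun n => cap4 (S ∩ boxSet (gridPoint r t n) (3 * r))]
    have := (sum_cap4_inter_boxSet_three_mul_le hS r t P).trans (hsum _)
    have h0 : 0 ≤ gridCap S r t := tsum_nonneg fun _ => cap4_nonneg _
    linarith
end
end
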